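/- arXiv:2212.07122 — 5 statements merged into one kernel-verified Lean document; each statement's English description precedes it below -/
import Mathlib

section
/- Every 𝔞-relative Gorenstein R-module M with M ≠ 𝔞M is 𝔞-relative maximal Cohen-Macaulay, and every 𝔞-relative maximal Cohen-Macaulay module is 𝔞-relative Cohen-Macaulay. -/
open CategoryTheory Opposite
open scoped TensorProduct

universe u

variable (R : Type u) [CommRing R]

/-- The Ext module `Ext^i_R(R/a, M)` as an object of `ModuleCat R`. -/
noncomputable def relExt (a : Ideal R) (i : ℕ)
    (M : Type u) [AddCommGroup M] [Module R M] : ModuleCat R :=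
  ((Ext R (ModuleCat R) i).obj (op (ModuleCat.of R (R ⧸ a)))).obj (ModuleCat.of R M)

/-- `grade(a, M) = inf { i | Ext^i_R(R/a, M) ≠ 0 }`. -/
noncomputable def rgrade (a : Ideal R) (M : Type u) [AddCommGroup M] [Module R M] : ℕ :=
  sInf {i | Nontrivial (relExt R a i M)}

/-- The local cohomology module `H^i_a(M)` as an object of `ModuleCat R`. -/
noncomputable def localCoh (a : Ideal R) (i : ℕ)
    (M : Type u) [AddCommGroup M] [Module R M] : ModuleCat R :=
  (localCohomology a i).obj (ModuleCat.of R M)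

/-- `cd(a, M) = sup { i | H^i_a(M) ≠ 0 }` (cohomological dimension). -/
noncomputable def rcd (a : Ideal R) (M : Type u) [AddCommGroup M] [Module R M] : ℕ :=
  sSup {i | Nontrivial (localCoh R a i M)}

/-- `M` is `a`-relative Cohen-Macaulay: `M = aM`, or `M ≠ aM` and
`grade(a,M) = cd(a,M)`. -/
def IsRelCM (a : Ideal R) (M : Type u) [AddCommGroup M] [Module R M] : Prop :=
  (a • (⊤ : Submodule R M) = ⊤) ∨
    (a • (⊤ : Submodule R M) ≠ ⊤ ∧ rgrade R a M = rcd R a M)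

/-- `ara(a, M)`: the arithmetic rank of `a` with respect to `M`. -/
noncomputable def ara (a : Ideal R) (M : Type u) [AddCommGroup M] [Module R M] : ℕ :=
  sInf {n | ∃ x : Fin n → R,
    (Ideal.span (Set.range x) + Module.annihilator R M).radical
      = (a + Module.annihilator R M).radical}

/-- Projective dimension of `M`, characterized by Ext-vanishing, valued in `ℕ∞`. -/
noncomputable def rpd (M : Type u) [AddCommGroup M] [Module R M] : ℕ∞ :=
  sSup ((fun i : ℕ => (i : ℕ∞)) '' {i : ℕ | ∃ N : ModuleCat R,
    Nontrivial (((Ext R (ModuleCat R) i).obj (op (ModuleCat.of R M))).obj N)})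

/-- Injective dimension of `M`, characterized by Ext-vanishing, valued in `ℕ∞`. -/
noncomputable def rid (M : Type u) [AddCommGroup M] [Module R M] : ℕ∞ :=
  sSup ((fun i : ℕ => (i : ℕ∞)) '' {i : ℕ | ∃ N : ModuleCat R,
    Nontrivial (((Ext R (ModuleCat R) i).obj (op N)).obj (ModuleCat.of R M))})

/-- The `a`-relative injective dimension `a-id_R M = sup{i | Ext^i(R/a, M) ≠ 0}`,
valued in `ℕ∞`. -/
noncomputable def raid (a : Ideal R) (M : Type u) [AddCommGroup M] [Module R M] : ℕ∞ :=
  sSup ((fun i : ℕ => (i : ℕ∞)) '' {i : ℕ | Nontrivial (relExt R a i M)})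

/-- `μ(a)`: the minimal number of generators of the ideal `a`. -/
noncomputable def mu (a : Ideal R) : ℕ :=
  sInf {n | ∃ s : Finset R, s.card = n ∧ Ideal.span (↑s : Set R) = a}

/-- `R` is `a`-relative regular: `a` is generated by an `R`-regular sequence of
length `cd(a,R)`. -/
def IsRelRegularRing (a : Ideal R) : Prop :=
  ∃ rs : List R, RingTheory.Sequence.IsRegular R rs ∧ rs.length = rcd R a R ∧
    Ideal.ofList rs = a

/-- `M` is an `a`-relative regular module: `M = aM`, or `M ≠ aM` and `a` is generated by
a sequence of length `cd(a,R)` that is both an `M`-regular and an `R`-regular sequence. -/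
def IsRelRegularMod (a : Ideal R) (M : Type u) [AddCommGroup M] [Module R M] : Prop :=
  (a • (⊤ : Submodule R M) = ⊤) ∨
    (a • (⊤ : Submodule R M) ≠ ⊤ ∧ ∃ rs : List R, rs.length = rcd R a R ∧
      Ideal.ofList rs = a ∧ RingTheory.Sequence.IsRegular M rs ∧
      RingTheory.Sequence.IsRegular R rs)

open CategoryTheory Opposite

namespace Bridge
variable {R : Type u} [CommRing R]

section abs
variable (K L : ChainComplex (ModuleCat.{u} R)ᵒᵖ ℕ)

def Rep (n : ℕ) (f : (K.X n).unop) (h : (K.homology n).unop) : Prop :=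
  ∃ z : (K.opcycles n).unop, (K.pOpcycles n).unop z = f ∧ (K.homologyι n).unop z = h

lemma rep_surj (n : ℕ) (h : (K.homology n).unop) : ∃ f, Rep K n f h := by
  have : Epi (K.homologyι n).unop := inferInstance
  obtain ⟨z, hz⟩ := (ModuleCat.epi_iff_surjective _).1 this h
  exact ⟨_, z, rfl, hz⟩

lemma rep_d (n : ℕ) {f} {h} (H : Rep K n f h) : (K.d (n+1) n).unop f = 0 := by
  obtain ⟨z, rfl, rfl⟩ := H
  have : (K.pOpcycles n).unop ≫ (K.d (n+1) n).unop = 0 := by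
    rw [← unop_comp, K.d_pOpcycles]; rfl
  rw [← ModuleCat.comp_apply, this]; rfl

lemma rep_ex (n : ℕ) (f) (hf : (K.d (n+1) n).unop f = 0) : ∃ h, Rep K n f h := by
  have hex := (ShortComplex.exact_of_g_is_cokernel
    (ShortComplex.mk _ _ (K.d_pOpcycles (n+1) n)) (K.opcyclesIsCokernel (n+1) n (by simp))).unop
  rw [ShortComplex.moduleCat_exact_iff] at hex
  obtain ⟨z, hz⟩ := hex f hf
  exact ⟨_, z, hz, rfl⟩

lemma rep_zero (n : ℕ) {f} {h} (H : Rep K n f h) :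
    h = 0 ↔ ∃ g, (K.d n ((ComplexShape.down ℕ).next n)).unop g = f := by
  obtain ⟨z, rfl, rfl⟩ := H
  set j := (ComplexShape.down ℕ).next n with hj
  have hex := (ShortComplex.exact_of_f_is_kernel
    (ShortComplex.mk _ _ (K.homologyι_comp_fromOpcycles n j)) (K.homologyIsKernel n j hj.symm)).unop
  rw [ShortComplex.moduleCat_exact_iff] at hex
  have hd : (K.fromOpcycles n j).unop ≫ (K.pOpcycles n).unop = (K.d n j).unop := by
    rw [← unop_comp, K.p_fromOpcycles]
  have hinj : Function.Injective (K.pOpcycles n).unop :=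
    (ModuleCat.mono_iff_injective _).1 inferInstance
  constructor
  · intro h0
    obtain ⟨g, hg⟩ := hex z h0
    refine ⟨g, ?_⟩
    rw [← hd]
    exact congrArg (K.pOpcycles n).unop hg
  · rintro ⟨g, hg⟩
    rw [← hd, ModuleCat.comp_apply] at hg
    have := hinj hg
    rw [← this, ← ModuleCat.comp_apply, ← unop_comp, K.homologyι_comp_fromOpcycles]; rfl

variable {K L}
lemma rep_map (n : ℕ) (ψ : K ⟶ L) {f} {h} (H : Rep L n f h) :
    Rep K n ((ψ.f n).unop f) ((HomologicalComplex.homologyMap ψ n).unop h) := by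
  obtain ⟨z, rfl, rfl⟩ := H
  refine ⟨(HomologicalComplex.opcyclesMap ψ n).unop z, ?_, ?_⟩
  · rw [← ModuleCat.comp_apply, ← ModuleCat.comp_apply, ← unop_comp, ← unop_comp,
      HomologicalComplex.p_opcyclesMap]
  · rw [← ModuleCat.comp_apply, ← ModuleCat.comp_apply, ← unop_comp, ← unop_comp,
      HomologicalComplex.homologyι_naturality]
end abs

noncomputable abbrev OExt (n : ℕ) (X Y : ModuleCat.{u} R) : ModuleCat.{u} R :=
  ((Ext R (ModuleCat.{u} R) n).obj (op X)).obj Y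

noncomputable abbrev KK {X : ModuleCat.{u} R} (P : ProjectiveResolution X) (Y : ModuleCat.{u} R) :
    ChainComplex (ModuleCat.{u} R)ᵒᵖ ℕ :=
  (((linearYoneda R (ModuleCat.{u} R)).obj Y).rightOp.mapHomologicalComplex _).obj P.complex

noncomputable def oiso {X : ModuleCat.{u} R} (P : ProjectiveResolution X) (Y : ModuleCat.{u} R) (n : ℕ) :
    ((KK P Y).homology n).unop ≅ OExt n X Y :=
  (P.isoLeftDerivedObj ((linearYoneda R (ModuleCat.{u} R)).obj Y).rightOp n).unop

noncomputable def kkmap {X X' : ModuleCat.{u} R} {P : ProjectiveResolution X}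
    {P' : ProjectiveResolution X'} (φ : P'.complex ⟶ P.complex) (Y : ModuleCat.{u} R) :
    KK P' Y ⟶ KK P Y :=
  (((linearYoneda R (ModuleCat.{u} R)).obj Y).rightOp.mapHomologicalComplex _).map φ

lemma oiso_nat {X X' : ModuleCat.{u} R} {P : ProjectiveResolution X}
    {P' : ProjectiveResolution X'} {g : X' ⟶ X} (φ : ProjectiveResolution.Hom P' P g)
    (Y : ModuleCat.{u} R) (n : ℕ) (h : ((KK P Y).homology n).unop) :
    ((Ext R (ModuleCat.{u} R) n).map g.op).app Y ((oiso P Y n).hom h) =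
      (oiso P' Y n).hom ((HomologicalComplex.homologyMap (kkmap φ.hom Y) n).unop h) := by
  have := ProjectiveResolution.isoLeftDerivedObj_hom_naturality g P' P φ.hom
    (by simpa using φ.hom_f_zero_comp_π_f_zero) ((linearYoneda R (ModuleCat.{u} R)).obj Y).rightOp n
  have := congrArg Quiver.Hom.unop this
  exact ConcreteCategory.congr_hom this h

def ORep {X Y : ModuleCat.{u} R} (P : ProjectiveResolution X) {n : ℕ}
    (f : P.complex.X n ⟶ Y) (e : OExt n X Y) : Prop :=
  ∃ h, Rep (KK P Y) n f h ∧ (oiso P Y n).hom h = e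

lemma orep_surj {X Y : ModuleCat.{u} R} (P : ProjectiveResolution X) {n : ℕ} (e : OExt n X Y) :
    ∃ f, P.complex.d (n+1) n ≫ f = 0 ∧ ORep P f e := by
  obtain ⟨f, hf⟩ := rep_surj (KK P Y) n ((oiso P Y n).inv e)
  exact ⟨f, rep_d _ _ hf, _, hf, by simp⟩

lemma orep_ex {X Y : ModuleCat.{u} R} (P : ProjectiveResolution X) {n : ℕ} (f : P.complex.X n ⟶ Y)
    (hf : P.complex.d (n+1) n ≫ f = 0) : ∃ e, ORep P f e := by
  obtain ⟨h, hh⟩ := rep_ex (KK P Y) n f hf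
  exact ⟨_, _, hh, rfl⟩

lemma orep_zero {X Y : ModuleCat.{u} R} {P : ProjectiveResolution X} {n : ℕ} {f : P.complex.X n ⟶ Y}
    {e} (H : ORep P f e) :
    e = 0 ↔ ∃ g, P.complex.d n ((ComplexShape.down ℕ).next n) ≫ g = f := by
  obtain ⟨h, hh, rfl⟩ := H
  have hinj : Function.Injective (oiso P Y n).hom :=
    (ModuleCat.mono_iff_injective _).1 inferInstance
  rw [map_eq_zero_iff _ hinj, rep_zero _ _ hh]
  rfl

lemma orep_map {X X' Y : ModuleCat.{u} R} {P : ProjectiveResolution X}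
    {P' : ProjectiveResolution X'} {g : X' ⟶ X} (φ : ProjectiveResolution.Hom P' P g)
    {n : ℕ} {f : P.complex.X n ⟶ Y} {e} (H : ORep P f e) :
    ORep P' (φ.hom.f n ≫ f) (((Ext R (ModuleCat.{u} R) n).map g.op).app Y e) := by
  obtain ⟨h, hh, rfl⟩ := H
  exact ⟨_, rep_map n (kkmap φ.hom Y) hh, (oiso_nat φ Y n h).symm⟩

lemma extMk_zero_iff {X Y : ModuleCat.{u} R} (P : ProjectiveResolution X) {n : ℕ}
    (f : P.complex.X n ⟶ Y) (hf : P.complex.d (n+1) n ≫ f = 0) :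
    P.extMk f (n+1) rfl hf = 0 ↔
      ∃ g, P.complex.d n ((ComplexShape.down ℕ).next n) ≫ g = f := by
  cases n with
  | succ n =>
    have : (ComplexShape.down ℕ).next (n+1) = n := by simp
    rw [this]
    exact P.extMk_eq_zero_iff f _ rfl hf n rfl
  | zero =>
    have h0 : P.complex.d 0 ((ComplexShape.down ℕ).next 0) = 0 :=
      P.complex.shape _ _ (by simp)
    simp only [h0, Limits.zero_comp, exists_const]
    constructor
    · intro h
      rw [← P.extEquivCohomologyClass.apply_eq_iff_eq,
        ProjectiveResolution.extEquivCohomologyClass_extMk,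
        ProjectiveResolution.extEquivCohomologyClass_zero,
        CochainComplex.HomComplex.CohomologyClass.mk_eq_zero_iff,
        CochainComplex.HomComplex.Cocycle.toSingleMk_mem_coboundaries_iff _ _ _ _ _ 1 (by simp)] at h
      obtain ⟨g, hg⟩ := h
      have hz : Limits.IsZero (P.cochainComplex.X 1) :=
        P.cochainComplex.isZero_of_isStrictlyLE 0 1 (by norm_num)
      rw [hz.eq_of_src g 0, Limits.comp_zero] at hg
      rw [← cancel_epi (P.cochainComplexXIso (-((0:ℕ):ℤ)) 0 rfl).hom, ← hg, Limits.comp_zero]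
    · rintro rfl
      simp

variable {X Y : ModuleCat.{u} R}

noncomputable def pres (X : ModuleCat.{u} R) : ProjectiveResolution X := projectiveResolution X

lemma rel_iff {n : ℕ} {f : (pres X).complex.X n ⟶ Y} {e} (H : ORep (pres X) f e)
    (hf : (pres X).complex.d (n+1) n ≫ f = 0) (X' : ModuleCat.{u} R) (g : X' ⟶ X) :
    ((Ext R (ModuleCat.{u} R) n).map g.op).app Y e = 0 ↔
      (Abelian.Ext.mk₀ g).comp ((pres X).extMk f (n+1) rfl hf) (zero_add n) = 0 := by
  let φ : ProjectiveResolution.Hom (pres X') (pres X) g := 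
    ⟨ProjectiveResolution.lift g _ _, by
      exact HomologicalComplex.congr_hom (ProjectiveResolution.lift_commutes g (pres X') (pres X)) 0⟩
  rw [ProjectiveResolution.mk₀_comp_extMk _ _ _ _ φ, orep_zero (orep_map φ H), extMk_zero_iff]

lemma bridge₁ {n : ℕ} (e : OExt n X Y) : ∃ x : Abelian.Ext X Y n, 
    ∀ (X' : ModuleCat.{u} R) (g : X' ⟶ X),
    ((Ext R (ModuleCat.{u} R) n).map g.op).app Y e = 0 ↔
      (Abelian.Ext.mk₀ g).comp x (zero_add n) = 0 := by
  obtain ⟨f, hf, H⟩ := orep_surj (pres X) e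
  exact ⟨_, rel_iff H hf⟩

lemma bridge₂ {n : ℕ} (x : Abelian.Ext X Y n) : ∃ e : OExt n X Y, 
    ∀ (X' : ModuleCat.{u} R) (g : X' ⟶ X),
    ((Ext R (ModuleCat.{u} R) n).map g.op).app Y e = 0 ↔
      (Abelian.Ext.mk₀ g).comp x (zero_add n) = 0 := by
  obtain ⟨f, hf, rfl⟩ := (pres X).extMk_surjective x (n+1) rfl
  obtain ⟨e, H⟩ := orep_ex (pres X) f hf
  exact ⟨_, rel_iff H hf⟩

lemma subsingleton_iff {n : ℕ} : Subsingleton (OExt n X Y) ↔ Subsingleton (Abelian.Ext X Y n) := by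
  constructor
  · intro h
    refine subsingleton_of_forall_eq 0 fun x => ?_
    obtain ⟨e, he⟩ := bridge₂ x
    have := (he X (𝟙 X)).1 (by simp [Subsingleton.elim e 0])
    simpa using this
  · intro h
    refine subsingleton_of_forall_eq 0 fun e => ?_
    obtain ⟨x, hx⟩ := bridge₁ e
    have := (hx X (𝟙 X)).2 (by simp [Subsingleton.elim x 0])
    simpa using this
end Bridge
open CategoryTheory Opposite
namespace Bridge
variable {R : Type u} [CommRing R]

def fac {I J : Ideal R} (h : I ≤ J) : ModuleCat.of R (R ⧸ I) ⟶ ModuleCat.of R (R ⧸ J) :=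
  ModuleCat.ofHom (Submodule.mapQ I J LinearMap.id h)

lemma fac_comp {I J K : Ideal R} (h : I ≤ J) (h' : J ≤ K) :
    fac h ≫ fac h' = fac (h.trans h') := by
  ext; rfl

/-- restriction of Ext classes -/
noncomputable def res {I J : Ideal R} (h : I ≤ J) {M : ModuleCat.{u} R} {i : ℕ}
    (x : Abelian.Ext (ModuleCat.of R (R ⧸ J)) M i) : Abelian.Ext (ModuleCat.of R (R ⧸ I)) M i :=
  (Abelian.Ext.mk₀ (fac h)).comp x (zero_add i)

lemma res_res {I J K : Ideal R} (h : I ≤ J) (h' : J ≤ K) {M : ModuleCat.{u} R} {i : ℕ}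
    (x : Abelian.Ext (ModuleCat.of R (R ⧸ K)) M i) : res h (res h' x) = res (h.trans h') x := by
  simp [res, ← fac_comp h h']

@[simp] lemma res_zero {I J : Ideal R} (h : I ≤ J) {M : ModuleCat.{u} R} {i : ℕ} :
    res h (0 : Abelian.Ext (ModuleCat.of R (R ⧸ J)) M i) = 0 := by simp [res]

lemma localCoh_subsingleton_iff (a : Ideal R) (i : ℕ) (M : ModuleCat.{u} R) :
    Subsingleton ((localCohomology a i).obj M) ↔
      ∀ (t : ℕ) (x : Abelian.Ext (ModuleCat.of R (R ⧸ a ^ t)) M i),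
        ∃ (s : ℕ) (h : t ≤ s), res (Ideal.pow_le_pow_right h) x = 0 := by
  let D := localCohomology.diagram (localCohomology.idealPowersDiagram a) i
  have hF : Limits.PreservesFilteredColimitsOfSize.{0, 0} (forget (ModuleCat.{u} R)) :=
    Limits.preservesFilteredColimitsOfSize_of_univLE.{u, u} _
  have hP : Limits.PreservesColimit (D ⋙ (evaluation (ModuleCat R) (ModuleCat R)).obj M)
      (forget (ModuleCat R)) :=
    ((hF.preserves_filtered_colimits (ℕᵒᵖᵒᵖ)).preservesColimit)
  have hD := Limits.isColimitOfPreserves ((evaluation _ _).obj M) (Limits.colimit.isColimit D)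
  have key : ∀ (j : (ℕᵒᵖ)ᵒᵖ) (e : OExt i (ModuleCat.of R (R ⧸ a ^ (unop (unop j)))) M),
      ((((evaluation _ _).obj M).mapCocone (Limits.colimit.cocone D)).ι.app j) e = 0 ↔
      ∃ (s : ℕ) (h : unop (unop j) ≤ s), 
        ((Ext R (ModuleCat.{u} R) i).map (fac (Ideal.pow_le_pow_right (I := a) h)).op).app M e = 0 := by
    intro j e
    constructor
    · intro h
      have := (Limits.Concrete.isColimit_rep_eq_iff_exists (D ⋙ (evaluation _ _).obj M) hD
        (i := j) (j := j) e 0).1 (by rw [map_zero]; exact h)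
      obtain ⟨k, f, g, hfg⟩ := this
      rw [map_zero] at hfg
      exact ⟨unop (unop k), f.unop.unop.le, hfg⟩
    · rintro ⟨s, h, h0⟩
      have := (Limits.Concrete.isColimit_rep_eq_iff_exists (D ⋙ (evaluation _ _).obj M) hD
        (i := j) (j := j) e 0).2 ⟨op (op s), (homOfLE h).op.op, (homOfLE h).op.op, by
          rw [map_zero]; exact h0⟩
      rw [map_zero] at this
      exact this
  constructor
  · intro hs t x
    obtain ⟨e, he⟩ := bridge₂ x
    obtain ⟨s, h, h0⟩ := (key (op (op t)) e).1 (@Subsingleton.elim _ hs _ _)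
    exact ⟨s, h, (he _ _).1 h0⟩
  · intro H
    refine subsingleton_of_forall_eq 0 fun y => ?_
    obtain ⟨j, e, rfl⟩ := Limits.Concrete.isColimit_exists_rep (D ⋙ (evaluation _ _).obj M) hD y
    obtain ⟨x, hx⟩ := bridge₁ e
    obtain ⟨s, h, h0⟩ := H _ x
    exact (key j e).2 ⟨s, h, (hx _ _).2 h0⟩
end Bridge
open CategoryTheory Opposite
namespace Bridge
variable {R : Type u} [CommRing R]

lemma nat_δ {S₁ S₂ : ShortComplex (ModuleCat.{u} R)} (h₁ : S₁.ShortExact) (h₂ : S₂.ShortExact)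
    (f : S₁ ⟶ S₂) {M : ModuleCat.{u} R} {n m : ℕ} (y : Abelian.Ext S₂.X₁ M n) (h : 1 + n = m) :
    (Abelian.Ext.mk₀ f.τ₃).comp (h₂.extClass.comp y h) (zero_add m) =
      h₁.extClass.comp ((Abelian.Ext.mk₀ f.τ₁).comp y (zero_add n)) h := by
  rw [← Abelian.Ext.comp_assoc (a₁₂ := 1) _ _ _ (by lia) (by lia) (by lia),
    ← ShortComplex.ShortExact.extClass_naturality h₁ h₂ f,
    Abelian.Ext.comp_assoc (a₂₃ := n) _ _ _ (by lia) (by lia) (by lia)]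

lemma mkSES {A B C : Type u} [AddCommGroup A] [AddCommGroup B] [AddCommGroup C]
    [Module R A] [Module R B] [Module R C] (f : A →ₗ[R] B) (g : B →ₗ[R] C)
    (hfg : ModuleCat.ofHom f ≫ ModuleCat.ofHom g = 0) (hf : Function.Injective f)
    (hg : Function.Surjective g) (h : Function.Exact f g) :
    (ShortComplex.mk (ModuleCat.ofHom f) (ModuleCat.ofHom g) hfg).ShortExact where
  exact := (ShortComplex.ShortExact.moduleCat_exact_iff_function_exact _).2 h
  mono_f := (ModuleCat.mono_iff_injective _).2 hf
  epi_g := (ModuleCat.epi_iff_surjective _).2 hg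

/-- `0 → I → R → R/I → 0` -/
abbrev idS (I : Ideal R) : ShortComplex (ModuleCat.{u} R) :=
  ShortComplex.mk (ModuleCat.ofHom I.subtype) (ModuleCat.ofHom (Submodule.mkQ I)) (by
    ext x; exact (Submodule.Quotient.mk_eq_zero I).2 x.2)

lemma idS_exact (I : Ideal R) : (idS I).ShortExact :=
  mkSES _ _ _ I.subtype_injective I.mkQ_surjective (LinearMap.exact_subtype_mkQ I)

abbrev idSmap {I J : Ideal R} (h : I ≤ J) : idS I ⟶ idS J where
  τ₁ := ModuleCat.ofHom (Submodule.inclusion h)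
  τ₂ := 𝟙 _
  τ₃ := fac h
  comm₁₂ := rfl
  comm₂₃ := rfl

/-- Mayer-Vietoris -/
abbrev mvS (I J : Ideal R) : ShortComplex (ModuleCat.{u} R) :=
  ShortComplex.mk
    (ModuleCat.ofHom (LinearMap.prod (Submodule.mapQ (I ⊓ J) I LinearMap.id inf_le_left)
      (Submodule.mapQ (I ⊓ J) J LinearMap.id inf_le_right)))
    (ModuleCat.ofHom (Submodule.mapQ I (I ⊔ J) LinearMap.id le_sup_left ∘ₗ LinearMap.fst R _ _ -
      Submodule.mapQ J (I ⊔ J) LinearMap.id le_sup_right ∘ₗ LinearMap.snd R _ _)) (by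
    ext x; simp)

lemma mvS_exact (I J : Ideal R) : (mvS I J).ShortExact := by
  refine mkSES _ _ _ ?_ ?_ ?_
  · rw [← LinearMap.ker_eq_bot, LinearMap.ker_eq_bot']
    intro m hm
    obtain ⟨r, rfl⟩ := Submodule.mkQ_surjective _ m
    have h1 : Submodule.Quotient.mk (p := I) r = 0 := congrArg Prod.fst hm
    have h2 : Submodule.Quotient.mk (p := J) r = 0 := congrArg Prod.snd hm
    rw [Submodule.Quotient.mk_eq_zero] at h1 h2
    exact (Submodule.Quotient.mk_eq_zero _).2 ⟨h1, h2⟩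
  · intro m
    obtain ⟨r, rfl⟩ := Submodule.mkQ_surjective _ m
    exact ⟨(Submodule.mkQ _ r, 0), by simp⟩
  · rintro ⟨p, q⟩
    obtain ⟨r, rfl⟩ := Submodule.mkQ_surjective _ p
    obtain ⟨s, rfl⟩ := Submodule.mkQ_surjective _ q
    constructor
    · intro h
      have h' : Submodule.Quotient.mk (p := I ⊔ J) (r - s) = 0 := h
      rw [Submodule.Quotient.mk_eq_zero, Submodule.mem_sup] at h'
      obtain ⟨i, hi, j, hj, hij⟩ := h'
      refine ⟨Submodule.Quotient.mk (r - i), Prod.ext ?_ ?_⟩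
      · change Submodule.Quotient.mk (p := I) (r - i) = Submodule.Quotient.mk r
        rw [Submodule.Quotient.eq]
        simpa using hi
      · change Submodule.Quotient.mk (p := J) (r - i) = Submodule.Quotient.mk s
        rw [Submodule.Quotient.eq]
        have : r - i - s = j := by rw [sub_right_comm, ← hij]; ring
        rwa [this]
    · rintro ⟨m, hm⟩
      obtain ⟨t, rfl⟩ := Submodule.mkQ_surjective _ m
      rw [← hm]
      simp

abbrev mvSmap {I I' J J' : Ideal R} (h : I' ≤ I) (h' : J' ≤ J) : mvS I' J' ⟶ mvS I J where
  τ₁ := fac (inf_le_inf h h')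
  τ₂ := ModuleCat.ofHom (LinearMap.prodMap (Submodule.mapQ I' I LinearMap.id h)
    (Submodule.mapQ J' J LinearMap.id h'))
  τ₃ := fac (sup_le_sup h h')
  comm₁₂ := by
    apply ModuleCat.hom_ext
    refine LinearMap.ext fun x => ?_
    obtain ⟨r, rfl⟩ := Submodule.mkQ_surjective _ x
    rfl
  comm₂₃ := by
    apply ModuleCat.hom_ext
    refine LinearMap.ext fun x => ?_
    obtain ⟨p, q⟩ := x
    obtain ⟨r, rfl⟩ := Submodule.mkQ_surjective _ p
    obtain ⟨s, rfl⟩ := Submodule.mkQ_surjective _ q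
    rfl

lemma res_mv {K I J I' J' L : Ideal R} (hI : I ≤ K) (hJ : J ≤ K) (hI' : I' ≤ I) (hJ' : J' ≤ J)
    (hL : I' ⊓ J' ≤ L) (hL' : L ≤ I ⊓ J)
    {M : ModuleCat.{u} R} {n : ℕ} (x : Abelian.Ext (ModuleCat.of R (R ⧸ K)) M (n + 1))
    (h1 : res hI x = 0) (h2 : res hJ x = 0)
    (h3 : ∀ y : Abelian.Ext (ModuleCat.of R (R ⧸ (I ⊓ J))) M n, res hL' y = 0) :
    res (sup_le (hI'.trans hI) (hJ'.trans hJ)) x = 0 := by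
  have hg : (Abelian.Ext.mk₀ (mvS I J).g).comp (res (sup_le hI hJ) x) (zero_add _) = 0 := by
    let l : ModuleCat.of R (R ⧸ I) ⟶ (mvS I J).X₂ := ModuleCat.ofHom (LinearMap.inl R (R ⧸ I) (R ⧸ J))
    let r : ModuleCat.of R (R ⧸ J) ⟶ (mvS I J).X₂ := ModuleCat.ofHom (LinearMap.inr R (R ⧸ I) (R ⧸ J))
    let p : (mvS I J).X₂ ⟶ ModuleCat.of R (R ⧸ I) := ModuleCat.ofHom (LinearMap.fst R (R ⧸ I) (R ⧸ J))
    let q : (mvS I J).X₂ ⟶ ModuleCat.of R (R ⧸ J) := ModuleCat.ofHom (LinearMap.snd R (R ⧸ I) (R ⧸ J))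
    have e : (mvS I J).g = p ≫ fac le_sup_left - q ≫ fac le_sup_right := rfl
    rw [e, sub_eq_add_neg, Abelian.Ext.mk₀_add, Abelian.Ext.mk₀_neg, Abelian.Ext.add_comp,
      Abelian.Ext.neg_comp, ← Abelian.Ext.mk₀_comp_mk₀_assoc, ← Abelian.Ext.mk₀_comp_mk₀_assoc]
    have e1 : (Abelian.Ext.mk₀ (fac (le_sup_left : I ≤ I ⊔ J))).comp (res (sup_le hI hJ) x)
      (zero_add _) = 0 := (res_res le_sup_left (sup_le hI hJ) x).trans h1
    have e2 : (Abelian.Ext.mk₀ (fac (le_sup_right : J ≤ I ⊔ J))).comp (res (sup_le hI hJ) x)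
      (zero_add _) = 0 := (res_res le_sup_right (sup_le hI hJ) x).trans h2
    rw [e1, e2]; simp
  obtain ⟨y, hy⟩ := Abelian.Ext.contravariant_sequence_exact₃ (mvS_exact I J) _
    (res (sup_le hI hJ) x) hg (n₀ := n) (by lia)
  have := nat_δ (mvS_exact I' J') (mvS_exact I J) (mvSmap hI' hJ') y (by lia : 1 + n = n + 1)
  rw [hy] at this
  have hy0 : (Abelian.Ext.mk₀ (mvSmap hI' hJ').τ₁).comp y (zero_add n) = 0 := by
    exact (res_res hL hL' y).symm.trans ((congrArg (res hL) (h3 y)).trans (res_zero hL))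
  rw [hy0, Abelian.Ext.comp_zero] at this
  rw [← res_res (sup_le_sup hI' hJ') (sup_le hI hJ)]
  exact this

def Van (n : ℕ) (a : Ideal R) : Prop :=
  ∀ I : Ideal R, a ≤ I.radical → ∃ (I' : Ideal R) (h : I' ≤ I), a ≤ I'.radical ∧
    ∀ (M : ModuleCat.{u} R) (i : ℕ), n < i →
      ∀ x : Abelian.Ext (ModuleCat.of R (R ⧸ I)) M i, res h x = 0

lemma Van.mono {n m : ℕ} (h : n ≤ m) {a : Ideal R} (H : Van n a) : Van m a := by
  intro I hI
  obtain ⟨I', h', hr, H⟩ := H I hI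
  exact ⟨I', h', hr, fun M i hi => H M i (by lia)⟩

lemma Van.congr {n : ℕ} {a b : Ideal R} (h : a.radical = b.radical) (H : Van n a) : Van n b := by
  have key : ∀ I : Ideal R, a ≤ I.radical ↔ b ≤ I.radical := fun I => by
    rw [← Ideal.radical_le_radical_iff, h, Ideal.radical_le_radical_iff]
  intro I hI
  obtain ⟨I', h', hr, H⟩ := H I ((key I).2 hI)
  exact ⟨I', h', (key I').1 hr, H⟩

lemma van_bot : Van 1 (⊥ : Ideal R) := by
  intro I _
  refine ⟨⊥, bot_le, bot_le, fun M i hi x => ?_⟩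
  obtain ⟨n, rfl⟩ : ∃ n, i = n + 1 := ⟨i - 1, by lia⟩
  have : Module.Projective R (R ⧸ (⊥ : Ideal R)) :=
    Module.Projective.of_equiv (Submodule.quotEquivOfEqBot (⊥ : Ideal R) rfl).symm
  have : Projective (ModuleCat.of R (R ⧸ (⊥ : Ideal R))) :=
    (IsProjective.iff_projective _).1 this
  exact Abelian.Ext.eq_zero_of_projective _

lemma van_principal [IsNoetherianRing R] (x : R) : Van 1 (Ideal.span {x}) := by
  intro I hI
  obtain ⟨t, ht⟩ : x ∈ I.radical := hI (Ideal.mem_span_singleton_self x)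
  obtain ⟨T, hT⟩ : ∃ T : ℕ, ∀ s, T ≤ s → ∀ r : R, x ^ s * r = 0 → x ^ T * r = 0 := by
    let f : ℕ →o Submodule R R := ⟨fun n => LinearMap.ker (LinearMap.mulLeft R (x ^ n)), by
      intro n m hnm r hr
      obtain ⟨k, rfl⟩ := Nat.exists_eq_add_of_le hnm
      simp only [LinearMap.mem_ker, LinearMap.mulLeft_apply] at hr ⊢
      rw [pow_add, mul_right_comm, hr, zero_mul]⟩
    obtain ⟨T, hT⟩ := monotone_stabilizes_iff_noetherian.2 (inferInstance : IsNoetherian R R) f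
    refine ⟨T, fun s hs r hr => ?_⟩
    have : r ∈ f s := hr
    rw [← hT s hs] at this
    exact this
  have hle : Ideal.span {x ^ (T + t)} ≤ Ideal.span {x ^ t} := by
    rw [Ideal.span_singleton_le_span_singleton]; exact pow_dvd_pow _ (by lia)
  have hle' : Ideal.span {x ^ t} ≤ I := by
    rwa [Ideal.span_singleton_le_iff_mem]
  refine ⟨Ideal.span {x ^ (T + t)}, hle.trans hle', ?_, fun M i hi y => ?_⟩
  · rw [Ideal.span_singleton_le_iff_mem]
    exact ⟨_, Ideal.mem_span_singleton_self _⟩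
  obtain ⟨n, rfl⟩ : ∃ n, i = (n + 1) + 1 := ⟨i - 2, by lia⟩
  rw [← res_res hle hle']
  generalize res hle' y = z
  have hproj : Projective (ModuleCat.of R R) := (IsProjective.iff_projective _).1 inferInstance
  have hz : (Abelian.Ext.mk₀ (idS (Ideal.span {x ^ t})).g).comp z (zero_add _) = 0 :=
    @Abelian.Ext.eq_zero_of_projective _ _ _ _ (ModuleCat.of R R) _ _ hproj _
  obtain ⟨w, hw⟩ := Abelian.Ext.contravariant_sequence_exact₃ (idS_exact (Ideal.span {x ^ t})) _
    z hz (n₀ := n + 1) (by lia)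
  have := nat_δ (idS_exact _) (idS_exact _) (idSmap hle) w (by lia : 1 + (n+1) = n + 1 + 1)
  rw [hw] at this
  refine this.trans ?_
  -- the inclusion factors through a free module
  have hch : ∀ v : (Ideal.span {x ^ (T + t)} : Ideal R), ∃ r : R, x ^ (T + t) * r = v := fun v => by
    obtain ⟨r, hr⟩ := Ideal.mem_span_singleton'.1 v.2
    exact ⟨r, by rw [mul_comm, hr]⟩
  choose c hc using hch
  have hc' : ∀ (v : (Ideal.span {x ^ (T + t)} : Ideal R)) (r : R), x ^ (T + t) * r = v → x ^ T * c v = x ^ T * r := fun v r h => by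
    have := hT (T + t) (by lia) (c v - r) (by rw [mul_sub, hc, h, sub_self])
    rwa [mul_sub, sub_eq_zero] at this
  let α : (Ideal.span {x ^ (T + t)} : Ideal R) →ₗ[R] R :=
    { toFun := fun v => x ^ T * c v
      map_add' := fun v w => by
        rw [hc' (v + w) (c v + c w) (by rw [mul_add, hc, hc]; rfl), mul_add]
      map_smul' := fun r v => by
        rw [hc' (r • v) (r * c v) (by rw [mul_left_comm, hc]; rfl)]
        simp [mul_left_comm] }
  let β : R →ₗ[R] (Ideal.span {x ^ t} : Ideal R) :=
    LinearMap.toSpanSingleton R _ ⟨x ^ t, Ideal.mem_span_singleton_self _⟩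
  have hfac : (idSmap hle).τ₁ = ModuleCat.ofHom α ≫ ModuleCat.ofHom β := by
    apply ModuleCat.hom_ext
    refine LinearMap.ext fun (v : (Ideal.span {x ^ (T + t)} : Ideal R)) => Subtype.ext ?_
    change (v : R) = (x ^ T * c v) * x ^ t
    rw [← hc v]; ring
  rw [hfac, ← Abelian.Ext.mk₀_comp_mk₀_assoc,
    Abelian.Ext.eq_zero_of_projective ((Abelian.Ext.mk₀ (ModuleCat.ofHom β)).comp w _)]
  simp

lemma van_sup [IsNoetherianRing R] {n : ℕ} {b : Ideal R} {x : R} (hb : Van n b)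
    (hx : Van n (Ideal.span {x})) (hbx : Van n (b * Ideal.span {x})) :
    Van (n + 1) (b ⊔ Ideal.span {x}) := by
  intro K hK
  obtain ⟨I, hI, hIr, hIv⟩ := hb K (le_sup_left.trans hK)
  obtain ⟨J, hJ, hJr, hJv⟩ := hx K (le_sup_right.trans hK)
  obtain ⟨L, hL, hLr, hLv⟩ := hbx (I ⊓ J) (by
    rw [Ideal.radical_inf]
    exact le_inf (Ideal.mul_le_left.trans hIr) (Ideal.mul_le_right.trans hJr))
  obtain ⟨r, hr⟩ := Ideal.exists_pow_le_of_le_radical_of_fg hLr (IsNoetherian.noetherian _)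
  obtain ⟨k, hk⟩ := Ideal.exists_pow_inf_eq_pow_smul b (M := R) (Ideal.span {x ^ r})
  have hk' := hk (k + r) (by lia)
  have hmain : b ^ (k + r) ⊓ Ideal.span {x ^ r} ≤ L := by
    have e : b ^ (k + r) ⊓ Ideal.span {x ^ r} =
      b ^ (k + r) • (⊤ : Submodule R R) ⊓ Ideal.span {x ^ r} := by simp
    rw [e, hk', Nat.add_sub_cancel_left]
    refine le_trans (Submodule.smul_mono le_rfl inf_le_right) (le_trans ?_ hr)
    rw [mul_pow, Ideal.span_singleton_pow]
    exact le_rfl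
  refine ⟨(I ⊓ b ^ (k + r)) ⊔ (J ⊓ Ideal.span {x ^ r}),
    sup_le (inf_le_left.trans hI) (inf_le_left.trans hJ), ?_, fun M i hi y => ?_⟩
  · have h1 : b ≤ (I ⊓ b ^ (k + r)).radical := by
      rw [Ideal.radical_inf]
      exact le_inf hIr fun z hz => ⟨_, Ideal.pow_mem_pow hz _⟩
    have h2 : Ideal.span {x} ≤ (J ⊓ Ideal.span {x ^ r}).radical := by
      rw [Ideal.radical_inf]
      refine le_inf hJr ?_
      rw [Ideal.span_singleton_le_iff_mem]
      exact ⟨_, Ideal.mem_span_singleton_self _⟩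
    exact sup_le (h1.trans (Ideal.radical_mono le_sup_left))
      (h2.trans (Ideal.radical_mono le_sup_right))
  · obtain ⟨m, rfl⟩ : ∃ m, i = m + 1 := ⟨i - 1, by lia⟩
    exact res_mv hI hJ inf_le_left inf_le_left
      ((inf_le_inf inf_le_right inf_le_right).trans hmain) hL y
      (hIv M _ (by lia) y) (hJv M _ (by lia) y) (fun z => hLv M m (by lia) z)

lemma van_span [IsNoetherianRing R] (l : List R) : Van (l.length + 1) (Ideal.ofList l) := by
  generalize hn : l.length = n
  induction n generalizing l with
  | zero =>
    obtain rfl := List.length_eq_zero_iff.1 hn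
    simpa using van_bot
  | succ n ih =>
    obtain ⟨x, l, rfl⟩ := List.exists_cons_of_length_eq_add_one hn
    have hl : l.length = n := by simpa using hn
    rw [Ideal.ofList_cons, sup_comm]
    refine van_sup (ih l hl) ((van_principal x).mono (by lia)) ?_
    have : Ideal.ofList l * Ideal.span {x} = Ideal.ofList (l.map (· * x)) := by
      simp only [Ideal.ofList]
      rw [Ideal.span_mul_span']
      congr 1
      ext z; simp [Set.mem_mul]
    rw [this]
    exact ih _ (by simpa using hl)

lemma exists_van [IsNoetherianRing R] (a : Ideal R) : ∃ n, Van n a := by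
  obtain ⟨s, hs⟩ := IsNoetherian.noetherian a
  refine ⟨_, (?_ : Ideal.ofList s.toList = a) ▸ van_span s.toList⟩
  rw [← hs]; simp [Ideal.ofList]
end Bridge
open CategoryTheory Opposite
namespace Bridge
variable {R : Type u} [CommRing R]

lemma nonvan [IsNoetherianRing R] {J K : Ideal R} (h : J ≤ K) (h' : K ≤ J.radical)
    (M : ModuleCat.{u} R) [Module.Finite R M] (hM : K • (⊤ : Submodule R M) ≠ ⊤) (g : ℕ)
    (H : ∀ j < g, Subsingleton (Abelian.Ext (ModuleCat.of R (R ⧸ K)) M j))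
    (x : Abelian.Ext (ModuleCat.of R (R ⧸ K)) M g) (hx : res h x = 0) : x = 0 := by
  have hsurj : Function.Surjective (Submodule.mapQ J K LinearMap.id h) := by
    intro m
    obtain ⟨r, rfl⟩ := Submodule.mkQ_surjective _ m
    exact ⟨Submodule.mkQ _ r, rfl⟩
  cases g with
  | zero =>
    have : Epi (fac h) := (ModuleCat.epi_iff_surjective _).2 hsurj
    apply Abelian.Ext.precomp_mk₀_injective_of_epi M (fac h)
    rw [map_zero]
    exact hx
  | succ g =>
    obtain ⟨rs, hl, hm, hr⟩ := ModuleCat.exists_isRegular_of_exists_subsingleton_ext K (g + 1) M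
      hM.lt_top (ModuleCat.of R (R ⧸ K)) (by
        rw [Module.support_eq_zeroLocus, Ideal.annihilator_quotient]) H
    let κ := LinearMap.ker (Submodule.mapQ J K LinearMap.id h)
    have hsub : Subsingleton (Abelian.Ext (ModuleCat.of R κ) M g) := by
      refine ModuleCat.subsingleton_ext_of_exists_isRegular K (ModuleCat.of R κ) ?_ M hM.lt_top
        rs hm hr g (by lia)
      refine (Module.support_subset_of_injective κ.subtype κ.subtype_injective).trans ?_
      rw [Module.support_eq_zeroLocus, Ideal.annihilator_quotient,
        PrimeSpectrum.zeroLocus_subset_zeroLocus_iff]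
      exact h'
    have hS := LinearMap.shortExact_shortComplexKer hsurj
    obtain ⟨y, hy⟩ := Abelian.Ext.contravariant_sequence_exact₃ hS _ x hx (n₀ := g) (by lia)
    rw [← hy, @Subsingleton.elim _ hsub y 0, Abelian.Ext.comp_zero]

lemma exists_nontrivial [IsNoetherianRing R] (a : Ideal R) (M : Type u) [AddCommGroup M]
    [Module R M] [Module.Finite R M] (hM : a • (⊤ : Submodule R M) ≠ ⊤)
    (H : ∀ j, Subsingleton (Abelian.Ext (ModuleCat.of R (R ⧸ a)) (ModuleCat.of R M) j)) :
    False := by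
  let P : Submodule R M → Prop := fun N => a • ⊤ ⊔ N ≠ ⊤ ∧
    ∀ j, Subsingleton (Abelian.Ext (ModuleCat.of R (R ⧸ a)) (ModuleCat.of R (M ⧸ N)) j)
  have hP : P ⊥ := by
    refine ⟨by simpa using hM, fun j => ?_⟩
    have e : ModuleCat.of R (M ⧸ (⊥ : Submodule R M)) ≅ ModuleCat.of R M :=
      (Submodule.quotEquivOfEqBot (⊥ : Submodule R M) rfl).toModuleIso
    refine subsingleton_of_forall_eq 0 fun x => ?_
    have h0 : x.comp (Abelian.Ext.mk₀ e.hom) (add_zero j) = 0 := @Subsingleton.elim _ (H j) _ _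
    have := congrArg (fun z => z.comp (Abelian.Ext.mk₀ e.inv) (add_zero j)) h0
    simpa using this
  obtain ⟨N, ⟨hN, hE⟩, hmax⟩ := (wellFounded_gt (α := Submodule R M)).has_min {N | P N} ⟨⊥, hP⟩
  have h0 : Subsingleton ((R ⧸ a) →ₗ[R] (M ⧸ N)) := by
    have := hE 0
    have : Subsingleton (ModuleCat.of R (R ⧸ a) ⟶ ModuleCat.of R (M ⧸ N)) :=
      Abelian.Ext.addEquiv₀.subsingleton_congr.mp (hE 0)
    exact (ModuleCat.homAddEquiv (M := ModuleCat.of R (R ⧸ a)) (N := ModuleCat.of R (M ⧸ N))).symm.subsingleton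
  obtain ⟨x, hxa, hx⟩ := IsSMulRegular.subsingleton_linearMap_iff.mp h0
  rw [Ideal.annihilator_quotient] at hxa
  let N' : Submodule R M := N ⊔ LinearMap.range (LinearMap.lsmul R M x)
  have hNN' : N ≤ N' := le_sup_left
  have hlt : N < N' := by
    refine lt_of_le_of_ne hNN' fun he => hN ?_
    have : ∀ m : M, m ∈ N := fun m => by
      have h1 : x • m ∈ N := by
        rw [he]; exact Submodule.mem_sup_right ⟨m, rfl⟩
      have h2 : x • (Submodule.Quotient.mk m : M ⧸ N) = x • 0 := by
        rw [smul_zero]; exact (Submodule.Quotient.mk_eq_zero N).2 h1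
      exact (Submodule.Quotient.mk_eq_zero N).1 (hx h2)
    rw [eq_top_iff]
    exact fun m _ => Submodule.mem_sup_right (this m)
  refine hmax N' ⟨?_, fun j => ?_⟩ hlt
  · intro ht
    apply hN
    have h1 : LinearMap.range (LinearMap.lsmul R M x) ≤ a • (⊤ : Submodule R M) := by
      rintro _ ⟨m, rfl⟩
      exact Submodule.smul_mem_smul (N := (⊤ : Submodule R M)) hxa Submodule.mem_top
    have h2 : N' ≤ a • (⊤ : Submodule R M) ⊔ N :=
      sup_le le_sup_right (h1.trans le_sup_left)
    exact top_le_iff.1 (ht.symm.le.trans (sup_le le_sup_left h2))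
  · have hS : (ShortComplex.mk (ModuleCat.ofHom (LinearMap.lsmul R (M ⧸ N) x))
        (ModuleCat.ofHom (Submodule.mapQ N N' LinearMap.id hNN')) (by
          apply ModuleCat.hom_ext
          refine LinearMap.ext fun m => ?_
          obtain ⟨r, rfl⟩ := Submodule.mkQ_surjective _ m
          exact (Submodule.Quotient.mk_eq_zero N').2
            (Submodule.mem_sup_right ⟨r, rfl⟩))).ShortExact := by
      refine mkSES _ _ _ hx ?_ ?_
      · intro m
        obtain ⟨r, rfl⟩ := Submodule.mkQ_surjective _ m
        exact ⟨Submodule.mkQ _ r, rfl⟩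
      · intro m
        obtain ⟨r, rfl⟩ := Submodule.mkQ_surjective _ m
        constructor
        · intro h
          have h' : r ∈ N' := (Submodule.Quotient.mk_eq_zero N').1 h
          obtain ⟨n, hn, _, ⟨y, rfl⟩, rfl⟩ := Submodule.mem_sup.1 h'
          refine ⟨Submodule.Quotient.mk y, ?_⟩
          refine (Submodule.Quotient.eq N).2 (?_ : x • y - (n + x • y) ∈ N)
          simpa using hn
        · rintro ⟨m, hm⟩
          obtain ⟨s, rfl⟩ := Submodule.mkQ_surjective _ m
          rw [← hm]
          exact (Submodule.Quotient.mk_eq_zero N').2 (Submodule.mem_sup_right ⟨s, rfl⟩)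
    refine subsingleton_of_forall_eq 0 fun z => ?_
    obtain ⟨y, hy⟩ := Abelian.Ext.covariant_sequence_exact₃ _ hS z (n₁ := j + 1) rfl
      (@Subsingleton.elim _ (hE (j + 1)) _ _)
    rw [← hy, @Subsingleton.elim _ (hE j) y 0, Abelian.Ext.zero_comp]

def Z (a : Ideal R) (i : ℕ) (M : ModuleCat.{u} R) : Prop :=
  ∀ (t : ℕ) (x : Abelian.Ext (ModuleCat.of R (R ⧸ a ^ t)) M i),
        ∃ (s : ℕ) (h : t ≤ s), res (Ideal.pow_le_pow_right h) x = 0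

lemma exists_Z [IsNoetherianRing R] (a : Ideal R) : ∃ N, ∀ i, N < i → ∀ M, Z a i M := by
  obtain ⟨N, hN⟩ := exists_van a
  refine ⟨N, fun i hi M t x => ?_⟩
  obtain ⟨I', h, hr, hv⟩ := hN (a ^ t) (fun z hz => ⟨t, Ideal.pow_mem_pow hz t⟩)
  obtain ⟨s, hs⟩ := Ideal.exists_pow_le_of_le_radical_of_fg hr (IsNoetherian.noetherian _)
  refine ⟨max s t, le_max_right _ _, ?_⟩
  have := res_res ((Ideal.pow_le_pow_right (le_max_left s t)).trans hs) h x
  rw [← this, hv M i hi x, res_zero]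

lemma res_comp {I J : Ideal R} (h : I ≤ J) {M M' : ModuleCat.{u} R} {i j k : ℕ}
    (x : Abelian.Ext (ModuleCat.of R (R ⧸ J)) M i) (y : Abelian.Ext M M' j) (e : i + j = k) :
    res h (x.comp y e) = (res h x).comp y e := by
  unfold res
  rw [Abelian.Ext.comp_assoc (a₂₃ := k) _ _ _ (by lia) (by lia) (by lia)]

lemma Z_ext {a : Ideal R} {i : ℕ} {S : ShortComplex (ModuleCat.{u} R)} (hS : S.ShortExact)
    (h2 : Z a i S.X₂) (h1 : Z a (i + 1) S.X₁) : Z a i S.X₃ := by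
  intro t x
  obtain ⟨s, hs, h⟩ := h1 t (x.comp hS.extClass rfl)
  rw [res_comp] at h
  obtain ⟨y, hy⟩ := Abelian.Ext.covariant_sequence_exact₃ _ hS _ _ h
  obtain ⟨s', hs', h'⟩ := h2 s y
  refine ⟨s', hs.trans hs', ?_⟩
  rw [← res_res (Ideal.pow_le_pow_right hs') (Ideal.pow_le_pow_right hs), ← hy, res_comp, h',
    Abelian.Ext.zero_comp]

lemma Z_mid {a : Ideal R} {i : ℕ} {S : ShortComplex (ModuleCat.{u} R)} (hS : S.ShortExact)
    (h1 : Z a i S.X₁) (h3 : Z a i S.X₃) : Z a i S.X₂ := by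
  intro t x
  obtain ⟨s, hs, h⟩ := h3 t (x.comp (Abelian.Ext.mk₀ S.g) (add_zero i))
  rw [res_comp] at h
  obtain ⟨y, hy⟩ := Abelian.Ext.covariant_sequence_exact₂ _ hS _ h
  obtain ⟨s', hs', h'⟩ := h1 s y
  refine ⟨s', hs.trans hs', ?_⟩
  rw [← res_res (Ideal.pow_le_pow_right hs') (Ideal.pow_le_pow_right hs), ← hy, res_comp, h',
    Abelian.Ext.zero_comp]

lemma Z_iso {a : Ideal R} {i : ℕ} {M M' : ModuleCat.{u} R} (e : M ≅ M') (h : Z a i M) :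
    Z a i M' := by
  intro t x
  obtain ⟨s, hs, h⟩ := h t (x.comp (Abelian.Ext.mk₀ e.inv) (add_zero i))
  refine ⟨s, hs, ?_⟩
  rw [res_comp] at h
  have := congrArg (fun z => z.comp (Abelian.Ext.mk₀ e.hom) (add_zero i)) h
  simpa using this

lemma Z_pow {a : Ideal R} {i : ℕ} (h : Z a i (ModuleCat.of R R)) (n : ℕ) :
    Z a i (ModuleCat.of R (Fin n → R)) := by
  induction n with
  | zero =>
    intro t x
    refine ⟨t, le_rfl, ?_⟩
    have h0 : 𝟙 (ModuleCat.of R (Fin 0 → R)) = 0 := by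
      apply ModuleCat.hom_ext
      exact LinearMap.ext fun v => Subsingleton.elim _ _
    have : x = 0 := by
      rw [← Abelian.Ext.comp_mk₀_id x, h0, Abelian.Ext.mk₀_zero, Abelian.Ext.comp_zero]
    rw [this, res_zero]
  | succ n ih =>
    have hS : (ShortComplex.mk (ModuleCat.ofHom (LinearMap.inl R R (Fin n → R)))
        (ModuleCat.ofHom (LinearMap.snd R R (Fin n → R))) (by
          apply ModuleCat.hom_ext
          exact LinearMap.ext fun _ => rfl)).ShortExact :=
      mkSES _ _ _ LinearMap.inl_injective LinearMap.snd_surjective Function.Exact.inl_snd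
    exact Z_iso (Fin.consLinearEquiv R (fun _ : Fin (n + 1) => R)).toModuleIso (Z_mid hS h ih)

lemma Z_fg [IsNoetherianRing R] {a : Ideal R} {c : ℕ}
    (h : ∀ i, c < i → Z a i (ModuleCat.of R R)) :
    ∀ (M : Type u) [AddCommGroup M] [Module R M] [Module.Finite R M] (i : ℕ), c < i →
      Z a i (ModuleCat.of R M) := by
  obtain ⟨N, hN⟩ := exists_Z a
  suffices ∀ (k : ℕ) (M : Type u) [AddCommGroup M] [Module R M] [Module.Finite R M] (i : ℕ),
      c < i → N < i + k → Z a i (ModuleCat.of R M) from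
    fun M _ _ _ i hi => this (N + 1) M i hi (by lia)
  intro k
  induction k with
  | zero => intro M _ _ _ i _ hi; exact hN i hi _
  | succ k ih =>
    intro M _ _ _ i hc hi
    obtain ⟨n, f, hf⟩ := Module.Finite.exists_fin' R M
    exact Z_ext (LinearMap.shortExact_shortComplexKer hf) (Z_pow (h i hc) n)
      (ih (LinearMap.ker f) (i + 1) (by lia) (by lia))

end Bridge

/-- every `a`-relative Gorenstein module `M` with `M ≠ aM` is `a`-relative
maximal Cohen-Macaulay, and every `a`-relative maximal Cohen-Macaulay module is
`a`-relative Cohen-Macaulay. -/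
theorem stmt10 [IsNoetherianRing R] (a : Ideal R) (ha : a ≠ ⊤) :
    (∀ (M : Type u) [AddCommGroup M] [Module R M] [Module.Finite R M],
      (∀ i : ℕ, i ≠ rcd R a R → Subsingleton (relExt R a i M)) →
      a • (⊤ : Submodule R M) ≠ ⊤ → rgrade R a M = rcd R a R) ∧
    (∀ (M : Type u) [AddCommGroup M] [Module R M] [Module.Finite R M],
      rgrade R a M = rcd R a R → IsRelCM R a M) := by
  have hne : ∀ (M : Type u) [AddCommGroup M] [Module R M] [Module.Finite R M],
      a • (⊤ : Submodule R M) ≠ ⊤ → {i | Nontrivial (relExt R a i M)}.Nonempty := by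
    intro M _ _ _ hM
    by_contra hcon
    rw [Set.not_nonempty_iff_eq_empty] at hcon
    refine Bridge.exists_nontrivial a M hM fun j => ?_
    rw [← Bridge.subsingleton_iff]
    by_contra hj
    have : j ∈ {i | Nontrivial (relExt R a i M)} := not_subsingleton_iff_nontrivial.1 hj
    rw [hcon] at this
    exact this
  have hlc : ∀ (M : Type u) [AddCommGroup M] [Module R M] (i : ℕ),
      ¬ Nontrivial (localCoh R a i M) ↔ Bridge.Z a i (ModuleCat.of R M) := by
    intro M _ _ i
    rw [not_nontrivial_iff_subsingleton]
    exact Bridge.localCoh_subsingleton_iff a i (ModuleCat.of R M)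
  refine ⟨fun M _ _ _ h hM => ?_, fun M _ _ _ h => ?_⟩
  · have hmem : Nontrivial (relExt R a (rgrade R a M) M) := Nat.sInf_mem (hne M hM)
    by_contra hcon
    exact not_nontrivial_iff_subsingleton.2 (h _ hcon) hmem
  · by_cases hM : a • (⊤ : Submodule R M) = ⊤
    · exact Or.inl hM
    refine Or.inr ⟨hM, ?_⟩
    have hmem : Nontrivial (relExt R a (rgrade R a M) M) := Nat.sInf_mem (hne M hM)
    have hlow : ∀ j < rgrade R a M, Subsingleton
        (Abelian.Ext (ModuleCat.of R (R ⧸ a)) (ModuleCat.of R M) j) := fun j hj => by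
      rw [← Bridge.subsingleton_iff]
      exact not_nontrivial_iff_subsingleton.1 (Nat.notMem_of_lt_sInf hj)
    have hcR : ∀ i, rcd R a R < i → Bridge.Z a i (ModuleCat.of R R) := by
      intro i hi
      rw [← hlc]
      intro hcon
      obtain ⟨N, hN⟩ := Bridge.exists_Z a
      refine not_le_of_gt hi (le_csSup ⟨N, fun k hk => ?_⟩ hcon)
      by_contra hlt
      exact (hlc R k).2 (hN k (not_le.1 hlt) _) hk
    have hcM := Bridge.Z_fg hcR M
    have hg : Nontrivial (localCoh R a (rgrade R a M) M) := by
      by_contra hcon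
      rw [hlc] at hcon
      have h1 : Subsingleton (Abelian.Ext (ModuleCat.of R (R ⧸ a ^ 1)) (ModuleCat.of R M)
          (rgrade R a M)) := by
        refine subsingleton_of_forall_eq 0 fun x => ?_
        obtain ⟨s, hs, hx⟩ := hcon 1 x
        refine Bridge.nonvan (Ideal.pow_le_pow_right hs) ?_ _ ?_ _ ?_ x hx
        · rw [pow_one]
          exact fun z hz => ⟨s, Ideal.pow_mem_pow hz s⟩
        · rw [pow_one]; exact hM
        · rw [pow_one]; exact hlow
      rw [pow_one, ← Bridge.subsingleton_iff] at h1
      exact not_nontrivial_iff_subsingleton.2 h1 hmem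
    have hub : ∀ k ∈ {i | Nontrivial (localCoh R a i M)}, k ≤ rgrade R a M := by
      intro k hk
      by_contra hlt
      exact (hlc M k).2 (hcM k (h ▸ not_le.1 hlt)) hk
    exact le_antisymm (le_csSup ⟨_, hub⟩ hg) (csSup_le ⟨_, hg⟩ hub)
end

section
/- Let (R,𝔪) be a Noetherian local ring of dimension d and M a nonzero finitely generated R-module. Then M is Gorenstein (maximal Cohen-Macaulay of finite injective dimension) if and only if M is maximal Cohen-Macaulay and H^d_𝔪(M) is an Artinian injective R-module. -/
open CategoryTheory Opposite
open scoped TensorProduct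

universe u

variable (R : Type u) [CommRing R]

namespace GorAux
open Abelian

variable {R}
section compare
variable {X X' : ModuleCat.{u} R} (P : ProjectiveResolution X) (P' : ProjectiveResolution X')
  (Y : ModuleCat.{u} R) (n : ℕ)

noncomputable def yonMap {K L : ChainComplex (ModuleCat.{u} R) ℕ} (φ : K ⟶ L) :
    L.linearYonedaObj R Y ⟶ K.linearYonedaObj R Y :=
  (HomologicalComplex.unopFunctor _ _).map
    ((((linearYoneda R (ModuleCat.{u} R)).obj Y).rightOp.mapHomologicalComplex _).map φ).op

lemma yonMap_f {K L : ChainComplex (ModuleCat.{u} R) ℕ} (φ : K ⟶ L) (i : ℕ)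
    (x : L.X i ⟶ Y) : ((yonMap Y φ).f i).hom x = φ.f i ≫ x := rfl

lemma aux_comp {C : Type*} [Category C] {H U E H' U' E' : C} {b : H ⟶ U} {a : U ⟶ E}
    {b' : H' ⟶ U'} {a' : U' ⟶ E'} {hm : H ⟶ H'} {um : U ⟶ U'} {em : E ⟶ E'}
    (h : a ≫ em = um ≫ a') (h2 : b ≫ um = hm ≫ b') :
    (b ≫ a) ≫ em = hm ≫ b' ≫ a' := by
  rw [Category.assoc, h, ← Category.assoc, h2, Category.assoc]

lemma isoExt_nat {g : X' ⟶ X} (φ : ProjectiveResolution.Hom P' P g) :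
    (P.isoExt (R := R) n Y).inv ≫ ((_root_.Ext R (ModuleCat.{u} R) n).map g.op).app Y =
     HomologicalComplex.homologyMap (yonMap Y φ.hom) n ≫ (P'.isoExt n Y).inv := by
  have h := congrArg Quiver.Hom.unop (ProjectiveResolution.isoLeftDerivedObj_hom_naturality g P' P φ.hom
    (by exact φ.hom_f_zero_comp_π_f_zero) ((linearYoneda R (ModuleCat.{u} R)).obj Y).rightOp n)
  have h2 := congrArg Quiver.Hom.unop (HomologicalComplex.homologyOp_hom_naturality (yonMap Y φ.hom) n)
  exact aux_comp h h2


section sc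
variable (S S' : ShortComplex (ModuleCat.{u} R))

noncomputable def piS : LinearMap.ker S.g.hom →ₗ[R] S.homology :=
  (S.moduleCatCyclesIso.inv ≫ S.homologyπ).hom

lemma piS_surj : Function.Surjective (piS S) :=
  (ModuleCat.epi_iff_surjective (S.moduleCatCyclesIso.inv ≫ S.homologyπ)).1 inferInstance

lemma piS_ker (z : LinearMap.ker S.g.hom) : piS S z = 0 ↔ ∃ x : S.X₁, S.f.hom x = z.1 := by
  have : Function.Injective (S.moduleCatHomologyIso.inv).hom :=
    (ModuleCat.mono_iff_injective S.moduleCatHomologyIso.inv).1 inferInstance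
  have e := ConcreteCategory.congr_hom (ShortComplex.moduleCatCyclesIso_inv_π S) z
  have e' : piS S z = S.moduleCatHomologyIso.inv.hom (S.moduleCatLeftHomologyData.π.hom z) := e
  rw [e', map_eq_zero_iff _ this]
  refine (Submodule.Quotient.mk_eq_zero _).trans ?_
  constructor
  · rintro ⟨g, hg⟩
    exact ⟨g, congrArg Subtype.val hg⟩
  · rintro ⟨g, hg⟩
    exact ⟨g, Subtype.ext hg⟩

variable {S S'}
lemma piS_nat (φ : S ⟶ S') (z : LinearMap.ker S.g.hom) (z' : LinearMap.ker S'.g.hom)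
    (h : z'.1 = φ.τ₂.hom z.1) :
    (ShortComplex.homologyMap φ).hom (piS S z) = piS S' z' := by
  have h1 : (ShortComplex.cyclesMap φ).hom (S.moduleCatCyclesIso.inv.hom z) =
      S'.moduleCatCyclesIso.inv.hom z' := by
    have hi : Function.Injective S'.iCycles.hom := by
      rw [← ModuleCat.mono_iff_injective]; infer_instance
    apply hi
    have e1 := ConcreteCategory.congr_hom (ShortComplex.cyclesMap_i φ) (S.moduleCatCyclesIso.inv.hom z)
    have e2 := ConcreteCategory.congr_hom (S.moduleCatCyclesIso_inv_iCycles) z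
    have e3 := ConcreteCategory.congr_hom (S'.moduleCatCyclesIso_inv_iCycles) z'
    refine (e1.trans ?_).trans e3.symm
    refine Eq.trans ?_ h.symm
    exact congrArg φ.τ₂.hom e2
  have h2 := ConcreteCategory.congr_hom (ShortComplex.homologyπ_naturality φ) (S.moduleCatCyclesIso.inv.hom z)
  refine h2.trans ?_
  exact congrArg S'.homologyπ.hom h1
end sc

/-- cocycles -/
abbrev Zc : Type u := LinearMap.ker ((P.complex.linearYonedaObj R Y).sc n).g.hom

def Zh {P : ProjectiveResolution X} {Y : ModuleCat.{u} R} {n : ℕ} (z : Zc P Y n) : P.complex.X n ⟶ Y := z.1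

lemma Zc_prop (z : Zc P Y n) : P.complex.d ((ComplexShape.up ℕ).next n) n ≫ Zh z = 0 := z.2

noncomputable def newMap : Zc P Y n →ₗ[R] Abelian.Ext X Y n where
  toFun z := P.extMk (Zh z) ((ComplexShape.up ℕ).next n) (by simp) (Zc_prop P Y n z)
  map_add' z z' := (P.add_extMk _ _ _ _ _ _).symm
  map_smul' r z := by
    rw [RingHom.id_apply, Abelian.Ext.smul_eq_comp_mk₀, P.extMk_comp_mk₀]
    have : Zh (r • z) = r • Zh z := rfl
    simp [this]

noncomputable def oldMap : Zc P Y n →ₗ[R] (((_root_.Ext R (ModuleCat.{u} R) n).obj (op X)).obj Y) :=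
  (P.isoExt n Y).inv.hom ∘ₗ (piS ((P.complex.linearYonedaObj R Y).sc n))

lemma newMap_surj : Function.Surjective (newMap P Y n) := by
  intro α
  obtain ⟨f, hf, h⟩ := P.extMk_surjective α ((ComplexShape.up ℕ).next n) (by simp)
  exact ⟨⟨f, hf⟩, h⟩

lemma isoExt_inv_bij : Function.Bijective (P.isoExt (R := R) n Y).inv.hom :=
  (P.isoExt (R := R) n Y).symm.toLinearEquiv.bijective

lemma oldMap_surj : Function.Surjective (oldMap P Y n) :=
  (isoExt_inv_bij P Y n).2.comp (piS_surj _)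

lemma oldMap_ker (z : Zc P Y n) : oldMap P Y n z = 0 ↔
    ∃ g : P.complex.X ((ComplexShape.up ℕ).prev n) ⟶ Y,
      P.complex.d n ((ComplexShape.up ℕ).prev n) ≫ g = Zh z := 
  (map_eq_zero_iff _ (isoExt_inv_bij P Y n).1).trans (piS_ker _ z)

lemma newMap_ker (z : Zc P Y n) : newMap P Y n z = 0 ↔
    ∃ g : P.complex.X ((ComplexShape.up ℕ).prev n) ⟶ Y,
      P.complex.d n ((ComplexShape.up ℕ).prev n) ≫ g = Zh z := by
  cases n with
  | succ n => exact P.extMk_eq_zero_iff _ _ (by simp) (Zc_prop P Y _ z) _ (by simp)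
  | zero =>
    have h0 : P.complex.d 0 ((ComplexShape.up ℕ).prev 0) = 0 := by
      apply P.complex.shape; simp
    rw [h0]
    simp only [Limits.zero_comp, exists_const]
    change P.extMk (n := 0) (Zh z) _ (by simp) (Zc_prop P Y 0 z) = 0 ↔ _
    rw [← P.extEquivCohomologyClass.apply_eq_iff_eq,
      P.extEquivCohomologyClass_extMk, P.extEquivCohomologyClass_zero,
      CochainComplex.HomComplex.CohomologyClass.mk_eq_zero_iff,
      CochainComplex.HomComplex.Cocycle.toSingleMk_mem_coboundaries_iff _ _ _ _ _ 1 (by simp)]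
    have h1 : P.cochainComplex.d (-((0:ℕ):ℤ)) 1 = 0 := 
      (CochainComplex.isZero_of_isStrictlyLE P.cochainComplex 0 1 (by simp)).eq_of_tgt _ _
    rw [h1]
    constructor
    · rintro ⟨g, hg⟩
      rw [Limits.zero_comp, eq_comm] at hg
      have := (Preadditive.IsIso.comp_left_eq_zero _ _).1 hg
      exact this.symm
    · intro h
      exact ⟨0, by rw [← h]; simp⟩

noncomputable def cmpEquiv : (((_root_.Ext R (ModuleCat.{u} R) n).obj (op X)).obj Y) ≃ₗ[R]
    Abelian.Ext X Y n :=
  ((oldMap P Y n).quotKerEquivOfSurjective (oldMap_surj P Y n)).symm ≪≫ₗ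
    (Submodule.quotEquivOfEq _ _ (by
      ext z
      rw [LinearMap.mem_ker, LinearMap.mem_ker, oldMap_ker, newMap_ker])) ≪≫ₗ
    (newMap P Y n).quotKerEquivOfSurjective (newMap_surj P Y n)

lemma cmpEquiv_oldMap (z : Zc P Y n) : cmpEquiv P Y n (oldMap P Y n z) = newMap P Y n z := by
  have : ((oldMap P Y n).quotKerEquivOfSurjective (oldMap_surj P Y n)).symm (oldMap P Y n z) =
      Submodule.Quotient.mk z := by
    rw [LinearEquiv.symm_apply_eq]; rfl
  unfold cmpEquiv
  rw [LinearEquiv.trans_apply, LinearEquiv.trans_apply, this]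
  rfl

lemma cmpEquiv_nat (g : X' ⟶ X) (ξ : ((_root_.Ext R (ModuleCat.{u} R) n).obj (op X)).obj Y) :
    cmpEquiv P' Y n ((((_root_.Ext R (ModuleCat.{u} R) n).map g.op).app Y).hom ξ) =
      (Ext.mk₀ g).comp (cmpEquiv P Y n ξ) (zero_add n) := by
  obtain ⟨z, rfl⟩ := oldMap_surj P Y n ξ
  have φ : ProjectiveResolution.Hom P' P g :=
    { hom := ProjectiveResolution.lift g P' P
      hom_f_zero_comp_π_f_zero := ProjectiveResolution.lift_commutes_zero g P' P }
  rw [cmpEquiv_oldMap]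
  let z' : Zc P' Y n := ⟨φ.hom.f n ≫ Zh z, by
    have := Zc_prop P Y n z
    change P'.complex.d ((ComplexShape.up ℕ).next n) n ≫ φ.hom.f n ≫ Zh z = 0
    rw [← φ.hom.comm_assoc, this]; simp⟩
  have h1 : (((_root_.Ext R (ModuleCat.{u} R) n).map g.op).app Y).hom (oldMap P Y n z) =
      oldMap P' Y n z' := by
    have h := ConcreteCategory.congr_hom (isoExt_nat P P' Y n φ)
      (piS ((P.complex.linearYonedaObj R Y).sc n) z)
    refine h.trans ?_
    exact congrArg (P'.isoExt (R := R) n Y).inv.hom (piS_nat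
      ((HomologicalComplex.shortComplexFunctor _ _ n).map (yonMap Y φ.hom)) z z' rfl)
  rw [h1, cmpEquiv_oldMap]
  exact (P.mk₀_comp_extMk _ _ (by simp) (Zc_prop P Y n z) φ).symm
end compare
end GorAux

namespace GorAux
open Abelian
variable {R}

noncomputable def oldEquiv (X Y : ModuleCat.{u} R) (n : ℕ) :
    (((_root_.Ext R (ModuleCat.{u} R) n).obj (op X)).obj Y) ≃ₗ[R] Abelian.Ext X Y n :=
  cmpEquiv (projectiveResolution X) Y n

lemma oldEquiv_nat {X X' : ModuleCat.{u} R} (Y : ModuleCat.{u} R) (n : ℕ) (g : X' ⟶ X)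
    (ξ : ((_root_.Ext R (ModuleCat.{u} R) n).obj (op X)).obj Y) :
    oldEquiv X' Y n ((((_root_.Ext R (ModuleCat.{u} R) n).map g.op).app Y).hom ξ) =
      (Ext.mk₀ g).comp (oldEquiv X Y n ξ) (zero_add n) :=
  cmpEquiv_nat _ _ _ _ _ _

/-- `R/I^n` -/
abbrev Qm (I : Ideal R) (n : ℕ) : ModuleCat.{u} R := ModuleCat.of R (R ⧸ I ^ n)

/-- transition -/
def qm (I : Ideal R) {n l : ℕ} (h : n ≤ l) : Qm I l ⟶ Qm I n :=
  ModuleCat.ofHom (Submodule.mapQ _ _ LinearMap.id (Ideal.pow_le_pow_right h))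

structure ColimData (I : Ideal R) (M : ModuleCat.{u} R) (d : ℕ) (H : Type u) [AddCommGroup H]
    [Module R H] where
  ι : ∀ n, Ext (Qm I n) M d →ₗ[R] H
  compat : ∀ (n l : ℕ) (h : n ≤ l) (ξ : Ext (Qm I n) M d),
    ι l ((Ext.mk₀ (qm I h)).comp ξ (zero_add d)) = ι n ξ
  surj : ∀ x, ∃ n ξ, ι n ξ = x
  ker : ∀ n ξ, ι n ξ = 0 → ∃ (l : ℕ) (h : n ≤ l), (Ext.mk₀ (qm I h)).comp ξ (zero_add d) = 0

open localCohomology Limits in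
theorem exists_colimData (I : Ideal R) (M : Type u) [AddCommGroup M] [Module R M] (d : ℕ) :
    Nonempty (ColimData I (ModuleCat.of R M) d (localCoh R I d M)) := by
  let F := diagram (idealPowersDiagram I) d
  have := hasColimitDiagram.{u,0} (idealPowersDiagram I) d
  let Y := ModuleCat.of R M
  let D := ((evaluation (ModuleCat.{u} R) (ModuleCat.{u} R)).obj Y).mapCocone (colimit.cocone F)
  have hD : IsColimit D := isColimitOfPreserves _ (colimit.isColimit F)
  let j : ℕ → (ℕᵒᵖ)ᵒᵖ := fun n => op (op n)
  have pres : PreservesFilteredColimitsOfSize.{0, 0} (forget (ModuleCat.{u} R)) :=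
    preservesSmallestFilteredColimits_of_preservesFilteredColimits.{u,u} _
  let a : ∀ n, (((_root_.Ext R (ModuleCat.{u} R) d).obj (op (Qm I n))).obj Y) →ₗ[R]
    localCoh R I d M := fun n => (D.ι.app (j n)).hom
  have a1 : ∀ (n l : ℕ) (h : n ≤ l) (ξ : ((_root_.Ext R (ModuleCat.{u} R) d).obj (op (Qm I n))).obj Y),
      a l ((((_root_.Ext R (ModuleCat.{u} R) d).map (qm I h).op).app Y).hom ξ) = a n ξ := by
    intro n l h ξ
    exact ConcreteCategory.congr_hom (D.w (homOfLE h).op.op) ξ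
  have a2 : ∀ x, ∃ n ξ, a n ξ = x := by
    intro x
    obtain ⟨n, y, hy⟩ := Concrete.isColimit_exists_rep _ hD x
    exact ⟨n.unop.unop, y, hy⟩
  have a3 : ∀ n ξ, a n ξ = 0 → ∃ (l : ℕ) (h : n ≤ l),
      (((_root_.Ext R (ModuleCat.{u} R) d).map (qm I h).op).app Y).hom ξ = 0 := by
    intro n ξ h
    obtain ⟨k, f, g, hk⟩ := Concrete.isColimit_exists_of_rep_eq _ hD (i := j n) (j := j n) ξ
      (0 : ((_root_.Ext R (ModuleCat.{u} R) d).obj (op (Qm I n))).obj Y)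
      (h.trans (map_zero (a n)).symm)
    refine ⟨k.unop.unop, leOfHom f.unop.unop, ?_⟩
    exact hk.trans (map_zero ((F ⋙ (evaluation (ModuleCat.{u} R) (ModuleCat.{u} R)).obj Y).map g).hom)
  clear_value a
  refine ⟨⟨fun n => a n ∘ₗ (oldEquiv (Qm I n) Y d).symm.toLinearMap, ?_, ?_, ?_⟩⟩
  · intro n l h ξ
    obtain ⟨ξ, rfl⟩ := (oldEquiv (Qm I n) Y d).surjective ξ
    rw [← oldEquiv_nat]
    change a l ((oldEquiv (Qm I l) Y d).symm (oldEquiv (Qm I l) Y d _)) =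
      a n ((oldEquiv (Qm I n) Y d).symm (oldEquiv (Qm I n) Y d ξ))
    rw [LinearEquiv.symm_apply_apply, LinearEquiv.symm_apply_apply]
    exact a1 n l h ξ
  · intro x
    obtain ⟨n, y, hy⟩ := a2 x
    refine ⟨n, oldEquiv _ Y d y, ?_⟩
    simp only [LinearMap.comp_apply, LinearEquiv.coe_coe, LinearEquiv.symm_apply_apply]
    exact hy
  · intro n ξ h
    obtain ⟨ξ, rfl⟩ := (oldEquiv (Qm I n) Y d).surjective ξ
    simp only [LinearMap.comp_apply, LinearEquiv.coe_coe, LinearEquiv.symm_apply_apply] at h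
    obtain ⟨l, hl, e⟩ := a3 n ξ h
    refine ⟨l, hl, ?_⟩
    rw [← oldEquiv_nat, e, map_zero]
end GorAux

namespace GorAux
open Abelian

section E
/-- unbundled Ext -/
abbrev E (A : Type u) [AddCommGroup A] [Module R A] (Y : Type u) [AddCommGroup Y] [Module R Y]
    (i : ℕ) : Type u := Ext (ModuleCat.of R A) (ModuleCat.of R Y) i

variable {R}
variable {A B C D : Type u} [AddCommGroup A] [Module R A] [AddCommGroup B] [Module R B]
  [AddCommGroup C] [Module R C] [AddCommGroup D] [Module R D]
  {A' B' C' : Type u} [AddCommGroup A'] [Module R A'] [AddCommGroup B'] [Module R B']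
  [AddCommGroup C'] [Module R C']
  {Y Y' : Type u} [AddCommGroup Y] [Module R Y] [AddCommGroup Y'] [Module R Y'] {i : ℕ}

noncomputable def pull (f : A →ₗ[R] B) : E R B Y i →ₗ[R] E R A Y i :=
  (Ext.mk₀ (ModuleCat.ofHom f)).precompOfLinear R _ (zero_add i)

lemma pull_def (f : A →ₗ[R] B) (ξ : E R B Y i) :
  pull f ξ = (Ext.mk₀ (ModuleCat.ofHom f)).comp ξ (zero_add i) := rfl

noncomputable def push (f : Y →ₗ[R] Y') : E R A Y i →ₗ[R] E R A Y' i where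
  toFun ξ := ξ.comp (Ext.mk₀ (ModuleCat.ofHom f)) (add_zero i)
  map_add' := by intros; simp
  map_smul' := by intros; simp

lemma push_def (f : Y →ₗ[R] Y') (ξ : E R A Y i) :
  push f ξ = ξ.comp (Ext.mk₀ (ModuleCat.ofHom f)) (add_zero i) := rfl

lemma pull_id (ξ : E R A Y i) : pull (LinearMap.id : A →ₗ[R] A) ξ = ξ := by
  rw [pull_def]; exact Ext.mk₀_id_comp ξ

lemma pull_pull (f : A →ₗ[R] B) (g : B →ₗ[R] C) (ξ : E R C Y i) :
    pull f (pull g ξ) = pull (g ∘ₗ f) ξ := by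
  rw [pull_def, pull_def, pull_def, Ext.mk₀_comp_mk₀_assoc]; rfl

lemma pull_zero (ξ : E R B Y i) : pull (0 : A →ₗ[R] B) ξ = 0 := by
  rw [pull_def]
  have : ModuleCat.ofHom (0 : A →ₗ[R] B) = 0 := rfl
  rw [this]; simp

lemma pull_add (f g : A →ₗ[R] B) (ξ : E R B Y i) : pull (f + g) ξ = pull f ξ + pull g ξ := by
  rw [pull_def, pull_def, pull_def]
  have : ModuleCat.ofHom (f + g) = ModuleCat.ofHom f + ModuleCat.ofHom g := rfl
  rw [this, Ext.mk₀_add, Ext.add_comp]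

lemma pull_smul (r : R) (f : A →ₗ[R] B) (ξ : E R B Y i) : pull (r • f) ξ = r • pull f ξ := by
  rw [pull_def, pull_def]
  have : ModuleCat.ofHom (r • f) = r • ModuleCat.ofHom f := rfl
  rw [this, Ext.mk₀_smul]; simp

lemma pull_sum {ι : Type*} (s : Finset ι) (f : ι → (A →ₗ[R] B)) (ξ : E R B Y i) :
    pull (∑ j ∈ s, f j) ξ = ∑ j ∈ s, pull (f j) ξ := by
  classical
  induction s using Finset.induction_on with
  | empty => simp [pull_zero]
  | insert a s ha ih => rw [Finset.sum_insert ha, Finset.sum_insert ha, pull_add, ih]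

lemma push_smul_id (r : R) (ξ : E R A Y i) : push (r • (LinearMap.id : Y →ₗ[R] Y)) ξ = r • ξ := by
  rw [push_def]
  have : ModuleCat.ofHom (r • (LinearMap.id : Y →ₗ[R] Y)) = r • 𝟙 (ModuleCat.of R Y) := rfl
  rw [this, Ext.mk₀_smul]; simp

lemma push_push (f : Y →ₗ[R] Y') (g : Y' →ₗ[R] D) (ξ : E R A Y i) :
    push g (push f ξ) = push (g ∘ₗ f) ξ := by
  rw [push_def, push_def, push_def, Ext.comp_assoc_of_third_deg_zero, Ext.mk₀_comp_mk₀]; rfl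

lemma push_id (ξ : E R A Y i) : push (LinearMap.id : Y →ₗ[R] Y) ξ = ξ := by
  rw [push_def]; exact Ext.comp_mk₀_id ξ

lemma pull_push (f : A →ₗ[R] B) (g : Y →ₗ[R] Y') (ξ : E R B Y i) :
    pull f (push g ξ) = push g (pull f ξ) := by
  rw [pull_def, push_def, pull_def, push_def, Ext.comp_assoc_of_third_deg_zero]

structure SES (f : A →ₗ[R] B) (g : B →ₗ[R] C) : Prop where
  inj : Function.Injective f
  exact : Function.Exact f g
  surj : Function.Surjective g

lemma SES.ker (g : B →ₗ[R] C) (hg : Function.Surjective g) : SES (LinearMap.ker g).subtype g :=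
  ⟨Subtype.val_injective, LinearMap.exact_subtype_ker_map g, hg⟩

lemma SES.mkQ (p : Submodule R B) : SES p.subtype p.mkQ :=
  ⟨Subtype.val_injective, LinearMap.exact_subtype_mkQ p, p.mkQ_surjective⟩

/-- the short complex -/
abbrev SES.sc {f : A →ₗ[R] B} {g : B →ₗ[R] C} (h : SES f g) : ShortComplex (ModuleCat.{u} R) :=
  ShortComplex.mk (ModuleCat.ofHom f) (ModuleCat.ofHom g)
    (by rw [← ModuleCat.ofHom_comp, h.exact.linearMap_comp_eq_zero]; rfl)

lemma SES.se {f : A →ₗ[R] B} {g : B →ₗ[R] C} (h : SES f g) : h.sc.ShortExact where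
  exact := (ShortComplex.ShortExact.moduleCat_exact_iff_function_exact _).2 h.exact
  mono_f := (ModuleCat.mono_iff_injective _).2 h.inj
  epi_g := (ModuleCat.epi_iff_surjective _).2 h.surj

variable {f : A →ₗ[R] B} {g : B →ₗ[R] C}

noncomputable def SES.del (h : SES f g) : E R A Y i →ₗ[R] E R C Y (i+1) :=
  h.se.extClass.precompOfLinear R _ (add_comm 1 i)

lemma SES.del_def (h : SES f g) (ξ : E R A Y i) :
  h.del ξ = h.se.extClass.comp ξ (add_comm 1 i) := rfl

noncomputable def SES.cdel (h : SES f g) : E R D C i →ₗ[R] E R D A (i+1) where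
  toFun ξ := ξ.comp h.se.extClass rfl
  map_add' := by intros; simp
  map_smul' := by intros; simp

lemma SES.cdel_def (h : SES f g) (ξ : E R D C i) :
  h.cdel ξ = ξ.comp h.se.extClass rfl := rfl

lemma SES.ex₂ (h : SES f g) (ξ : E R B Y i) (hξ : pull f ξ = 0) : ∃ ζ : E R C Y i, pull g ζ = ξ :=
  Ext.contravariant_sequence_exact₂ h.se _ ξ hξ

lemma SES.ex₁ (h : SES f g) (η : E R A Y i) (hη : h.del η = 0) : ∃ ξ : E R B Y i, pull f ξ = η :=
  Ext.contravariant_sequence_exact₁ h.se _ η (add_comm 1 i) hη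

lemma SES.ex₃ (h : SES f g) (ζ : E R C Y (i+1)) (hζ : pull g ζ = 0) : ∃ η : E R A Y i, h.del η = ζ :=
  Ext.contravariant_sequence_exact₃ h.se _ ζ hζ (add_comm 1 i)

lemma SES.cex₂ (h : SES f g) (ξ : E R D B i) (hξ : push g ξ = 0) : ∃ ζ : E R D A i, push f ζ = ξ :=
  Ext.covariant_sequence_exact₂ _ h.se ξ hξ

lemma SES.cex₁ (h : SES f g) (ζ : E R D A (i+1)) (hζ : push f ζ = 0) : ∃ η : E R D C i, h.cdel η = ζ :=
  Ext.covariant_sequence_exact₁ _ h.se ζ hζ rfl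

lemma SES.pull_cdel (h : SES f g) (u : A' →ₗ[R] D) (ξ : E R D C i) :
    pull u (h.cdel ξ) = h.cdel (pull u ξ) := by
  rw [pull_def, SES.cdel_def, pull_def, SES.cdel_def, Ext.comp_assoc (Ext.mk₀ (ModuleCat.ofHom u)) ξ h.se.extClass (zero_add i) rfl (by omega)]

lemma SES.nat {f' : A' →ₗ[R] B'} {g' : B' →ₗ[R] C'} (h : SES f g) (h' : SES f' g')
    (a : A →ₗ[R] A') (b : B →ₗ[R] B') (c : C →ₗ[R] C') (h1 : b ∘ₗ f = f' ∘ₗ a)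
    (h2 : c ∘ₗ g = g' ∘ₗ b) (η : E R A' Y i) : pull c (h'.del η) = h.del (pull a η) := by
  have := ShortComplex.ShortExact.extClass_naturality h.se h'.se
    { τ₁ := ModuleCat.ofHom a, τ₂ := ModuleCat.ofHom b, τ₃ := ModuleCat.ofHom c
      comm₁₂ := by
        simp only [SES.sc]; rw [← ModuleCat.ofHom_comp, ← ModuleCat.ofHom_comp, h1]
      comm₂₃ := by
        simp only [SES.sc]; rw [← ModuleCat.ofHom_comp, ← ModuleCat.ofHom_comp, h2] }
  rw [pull_def, SES.del_def, pull_def, SES.del_def, 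
    ← Ext.comp_assoc (Ext.mk₀ (ModuleCat.ofHom c)) h'.se.extClass η (zero_add 1) (add_comm 1 i) (by omega),
    ← Ext.comp_assoc h.se.extClass (Ext.mk₀ (ModuleCat.ofHom a)) η (add_zero 1) (zero_add i) (by omega)]
  exact congrArg (fun z => Ext.comp z η (add_comm 1 i)) this.symm

lemma E_proj [Module.Projective R A] (ξ : E R A Y (i+1)) : ξ = 0 := by
  have : Projective (ModuleCat.of R A) := ModuleCat.projective_of_categoryTheory_projective _
  exact Ext.eq_zero_of_projective _

lemma E_inj [Module.Injective R Y] (ξ : E R A Y (i+1)) : ξ = 0 := by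
  have : Injective (ModuleCat.of R Y) := Module.injective_object_of_injective_module R Y
  exact Ext.eq_zero_of_injective _

lemma E_zero (ξ : E R A Y 0) : ∃ h : A →ₗ[R] Y, ∀ (B : Type u) [AddCommGroup B] [Module R B]
    (f : B →ₗ[R] A), pull f ξ = 0 ↔ h ∘ₗ f = 0 := by
  obtain ⟨h, rfl⟩ := Ext.homEquiv₀.symm.surjective ξ
  refine ⟨h.hom, fun B _ _ f => ?_⟩
  rw [pull_def]
  have : (Ext.mk₀ (ModuleCat.ofHom f)).comp (Ext.mk₀ h) (zero_add 0) = 0 ↔ ModuleCat.ofHom f ≫ h = 0 := by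
    rw [Ext.mk₀_comp_mk₀, Ext.mk₀_eq_zero_iff]
  refine this.trans ?_
  rw [ModuleCat.hom_ext_iff]; rfl

lemma E_subsing [Subsingleton A] (ξ : E R A Y i) : ξ = 0 := by
  rw [← pull_id ξ, Subsingleton.elim (LinearMap.id : A →ₗ[R] A) 0, pull_zero]

lemma E_zero_inj (g : B →ₗ[R] C) (hg : Function.Surjective g) (ξ : E R C Y 0)
    (h : pull g ξ = 0) : ξ = 0 := by
  obtain ⟨h', hh⟩ := E_zero ξ
  rw [hh] at h
  have : h' ∘ₗ LinearMap.id = 0 := by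
    ext c; obtain ⟨b, rfl⟩ := hg c; exact LinearMap.congr_fun h b
  rw [← hh, pull_id] at this
  exact this

lemma E_finite [IsNoetherianRing R] [Module.Finite R A] [Module.Finite R Y] :
    Module.Finite R (E R A Y i) := 
  ModuleCat.finite_ext R (ModuleCat.of R A) (ModuleCat.of R Y) i
end E
end GorAux

namespace GorAux
section eff
variable {R}
variable {A B C : Type u} [AddCommGroup A] [Module R A] [AddCommGroup B] [Module R B]
  [AddCommGroup C] [Module R C]

/-- finitely generated and killed by a power of `I` -/
def FL (I : Ideal R) (A : Type u) [AddCommGroup A] [Module R A] : Prop :=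
  Module.Finite R A ∧ ∃ n, ∀ r ∈ I ^ n, ∀ a : A, r • a = 0

lemma exists_free_ses [IsNoetherianRing R] (A : Type u) [AddCommGroup A] [Module R A] [Module.Finite R A] :
    ∃ (P : Type u) (_ : AddCommGroup P) (_ : Module R P) (_ : Module.Free R P) (_ : Module.Finite R P)
      (π : P →ₗ[R] A), Function.Surjective π := by
  obtain ⟨P, _, _, _, _, π, h⟩ := Module.exists_finite_presentation R A
  exact ⟨P, _, _, inferInstance, inferInstance, π, h⟩

lemma artin_rees [IsNoetherianRing R] (I : Ideal R) [Module.Finite R A] (L : Submodule R A) (n : ℕ) :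
    ∃ n' ≥ n, ∀ k ≥ n', ∀ x : L, (x : A) ∈ I ^ k • (⊤ : Submodule R A) → x ∈ I ^ n • (⊤ : Submodule R L) := by
  obtain ⟨k, hk⟩ := I.exists_pow_inf_eq_pow_smul L
  refine ⟨k + n, by omega, fun k' hk' x hx => ?_⟩
  have h1 : (x : A) ∈ I ^ k' • (⊤ : Submodule R A) ⊓ L := ⟨hx, x.2⟩
  rw [hk k' (by omega)] at h1
  have h2 : (x : A) ∈ I ^ n • L :=
    Submodule.smul_mono (Ideal.pow_le_pow_right (by omega)) inf_le_right h1
  have h3 : I ^ n • L = (I ^ n • (⊤ : Submodule R L)).map L.subtype := by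
    rw [Submodule.map_smul'']; simp
  rw [h3] at h2
  obtain ⟨y, hy, e⟩ := h2
  rwa [← Subtype.ext e]

lemma eff_aux [IsNoetherianRing R] (I : Ideal R) {Y : Type u} [AddCommGroup Y] [Module R Y]
    (j : ℕ) (hY : ∀ r ∈ I ^ j, ∀ y : Y, r • y = 0) (i : ℕ) :
    ∀ (K : Type u) [AddCommGroup K] [Module R K] [Module.Finite R K] (η : E R K Y i),
      ∃ n, ∀ (A : Type u) [AddCommGroup A] [Module R A] (f : A →ₗ[R] K),
        (∀ a, f a ∈ I ^ n • (⊤ : Submodule R K)) → pull f η = 0 := by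
  induction i with
  | zero =>
    intro K _ _ _ η
    obtain ⟨h, hh⟩ := E_zero η
    refine ⟨j, fun A _ _ f hf => ?_⟩
    rw [hh]
    ext a
    have : I ^ j • (⊤ : Submodule R K) ≤ LinearMap.ker h := by
      rw [Submodule.smul_le]
      intro r hr n _
      rw [LinearMap.mem_ker, map_smul, hY r hr]
    exact this (hf a)
  | succ i ih =>
    intro K _ _ _ η
    obtain ⟨P, _, _, _, _, π, hπ⟩ := exists_free_ses (R := R) K
    have S := SES.ker π hπ
    obtain ⟨θ, rfl⟩ := S.ex₃ η (E_proj _)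
    obtain ⟨n, hn⟩ := ih _ θ
    obtain ⟨n', _, hn'⟩ := artin_rees I (LinearMap.ker π) n
    refine ⟨n', fun A _ _ f hf => ?_⟩
    let W : Submodule R (P × A) := ((I ^ n' • (⊤ : Submodule R P)).comap (LinearMap.fst R P A)) ⊓
      LinearMap.ker (π ∘ₗ LinearMap.fst R P A - f ∘ₗ LinearMap.snd R P A)
    have hW : ∀ w : W, π w.1.1 = f w.1.2 := fun w => sub_eq_zero.1 w.2.2
    let g : W →ₗ[R] A := LinearMap.snd R P A ∘ₗ W.subtype
    have hg : Function.Surjective g := by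
      intro a
      have h1 := hf a
      rw [← LinearMap.range_eq_top.2 hπ, LinearMap.range_eq_map, ← Submodule.map_smul''] at h1
      obtain ⟨p, hp, e⟩ := h1
      exact ⟨⟨(p, a), hp, sub_eq_zero.2 e⟩, rfl⟩
    have S' := SES.ker g hg
    let b : W →ₗ[R] P := LinearMap.fst R P A ∘ₗ W.subtype
    let a : LinearMap.ker g →ₗ[R] LinearMap.ker π :=
      (b ∘ₗ (LinearMap.ker g).subtype).codRestrict _ (fun x => by
        have h1 := hW x.1
        have h2 : x.1.1.2 = 0 := x.2
        rw [h2, map_zero] at h1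
        exact h1)
    rw [S'.nat S a b f rfl (by ext w; exact (hW w).symm) θ, hn, map_zero]
    intro x
    exact hn' n' le_rfl _ x.1.2.1

def Eff (I : Ideal R) (Y : Type u) [AddCommGroup Y] [Module R Y] (i : ℕ) : Prop :=
  ∀ (N : Type u) [AddCommGroup N] [Module R N], FL I N → ∀ ξ : E R N Y i,
    ∃ (B : Type u) (_ : AddCommGroup B) (_ : Module R B) (f : B →ₗ[R] N),
      FL I B ∧ Function.Surjective f ∧ pull f ξ = 0

lemma eff_killed [IsNoetherianRing R] (I : Ideal R) {Y : Type u} [AddCommGroup Y] [Module R Y]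
    (j : ℕ) (hY : ∀ r ∈ I ^ j, ∀ y : Y, r • y = 0) (i : ℕ) : Eff I Y (i+1) := by
  intro N _ _ hN ξ
  obtain ⟨_, s, hs⟩ := hN
  obtain ⟨P, _, _, _, _, π, hπ⟩ := exists_free_ses (R := R) N
  have S := SES.ker π hπ
  obtain ⟨θ, rfl⟩ := S.ex₃ ξ (E_proj _)
  obtain ⟨n, hn⟩ := eff_aux I j hY i _ θ
  obtain ⟨n', _, hn'⟩ := artin_rees I (LinearMap.ker π) n
  let q := max n' s
  have hle : I ^ q • (⊤ : Submodule R P) ≤ LinearMap.ker π := by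
    rw [Submodule.smul_le]
    intro r hr n _
    rw [LinearMap.mem_ker, map_smul, hs r (Ideal.pow_le_pow_right (le_max_right _ _) hr)]
  refine ⟨P ⧸ I ^ q • (⊤ : Submodule R P), inferInstance, inferInstance, Submodule.liftQ _ π hle,
    ⟨inferInstance, q, ?_⟩, ?_, ?_⟩
  · intro r hr a
    obtain ⟨p, rfl⟩ := Submodule.mkQ_surjective _ a
    rw [← map_smul, Submodule.mkQ_apply, Submodule.Quotient.mk_eq_zero]
    exact Submodule.smul_mem_smul hr trivial
  · intro x
    obtain ⟨p, rfl⟩ := hπ x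
    exact ⟨Submodule.Quotient.mk p, rfl⟩
  · rw [(SES.mkQ (I ^ q • (⊤ : Submodule R P))).nat S (Submodule.inclusion hle) LinearMap.id _ rfl rfl θ,
      hn, map_zero]
    intro x
    exact hn' q (le_max_left _ _) _ x.2

lemma Eff.ext {I : Ideal R} {f : A →ₗ[R] B} {g : B →ₗ[R] C} (S : SES f g) {i : ℕ}
    (hA : Eff I A i) (hC : Eff I C i) : Eff I B i := by
  intro N _ _ hN ξ
  obtain ⟨B1, _, _, f1, h1, s1, e1⟩ := hC N hN (push g ξ)
  rw [pull_push] at e1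
  obtain ⟨ζ, hζ⟩ := S.cex₂ _ e1
  obtain ⟨B2, _, _, f2, h2, s2, e2⟩ := hA B1 h1 ζ
  refine ⟨B2, _, _, f1 ∘ₗ f2, h2, s1.comp s2, ?_⟩
  rw [← pull_pull, ← hζ, pull_push, e2, map_zero]

lemma Eff.equiv {I : Ideal R} (e : A ≃ₗ[R] B) {i : ℕ} (hA : Eff I A i) : Eff I B i := by
  intro N _ _ hN ξ
  obtain ⟨B1, _, _, f1, h1, s1, e1⟩ := hA N hN (push e.symm.toLinearMap ξ)
  refine ⟨B1, _, _, f1, h1, s1, ?_⟩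
  have := congrArg (push e.toLinearMap) e1
  rw [← pull_push, push_push, LinearEquiv.comp_symm, push_id, map_zero] at this
  exact this

lemma Eff.del {I : Ideal R} {f : A →ₗ[R] B} {g : B →ₗ[R] C} {i : ℕ}
    (hC : Eff I C i)  (N : Type u) [AddCommGroup N] [Module R N] (hN : FL I N) (ξ : E R N A (i+1)) 
    (S : SES f g) (h : push f ξ = 0) : ∃ (B : Type u) (_ : AddCommGroup B) (_ : Module R B) (f : B →ₗ[R] N),
      FL I B ∧ Function.Surjective f ∧ pull f ξ = 0 := by
  obtain ⟨η, rfl⟩ := S.cex₁ ξ h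
  obtain ⟨B1, _, _, f1, h1, s1, e1⟩ := hC N hN η
  exact ⟨B1, _, _, f1, h1, s1, by rw [S.pull_cdel, e1, map_zero]⟩

lemma quot_smul_zero (J : Ideal R) (r : R) (hr : r ∈ J) (y : R ⧸ J) : r • y = 0 := by
  obtain ⟨y, rfl⟩ := Ideal.Quotient.mk_surjective y
  rw [Algebra.smul_def]
  exact Ideal.Quotient.eq_zero_iff_mem.2 (Ideal.mul_mem_right _ _ hr)

/-- `I` max ideal; primes of coheight `≤ e` -/
lemma eff_prime [IsNoetherianRing R] [IsLocalRing R] (e : ℕ) :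
    ∀ (p : PrimeSpectrum R), Order.coheight p ≤ e → ∀ i > e,
      Eff (IsLocalRing.maximalIdeal R) (R ⧸ p.asIdeal) i := by
  induction e using Nat.strong_induction_on with
  | _ e ih =>
  intro p hp i hi
  set m := IsLocalRing.maximalIdeal R with hm
  obtain ⟨i, rfl⟩ := Nat.exists_eq_succ_of_ne_zero (show i ≠ 0 by omega)
  by_cases hpm : p.asIdeal = m
  · apply eff_killed m 1
    intro r hr y
    exact quot_smul_zero _ r (by rw [hpm]; rwa [pow_one] at hr) y
  · obtain ⟨x, hx, hxp⟩ : ∃ x ∈ m, x ∉ p.asIdeal := by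
      by_contra! h
      exact hpm (le_antisymm (IsLocalRing.le_maximalIdeal p.2.ne_top) h)
    intro N _ _ hN ξ
    obtain ⟨hfin, s, hs⟩ := id hN
    let y := x ^ s
    have hyp : y ∉ p.asIdeal := fun h => hxp (p.2.mem_of_pow_mem _ h)
    let f : (R ⧸ p.asIdeal) →ₗ[R] (R ⧸ p.asIdeal) := y • LinearMap.id
    have hf : Function.Injective f := by
      rw [injective_iff_map_eq_zero]
      intro a ha
      obtain ⟨a, rfl⟩ := Ideal.Quotient.mk_surjective a
      have : y * a ∈ p.asIdeal := by
        rw [← Ideal.Quotient.eq_zero_iff_mem]; exact ha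
      exact Ideal.Quotient.eq_zero_iff_mem.2 ((p.2.mem_or_mem this).resolve_left hyp)
    have S : SES f (LinearMap.range f).mkQ :=
      ⟨hf, LinearMap.exact_map_mkQ_range f, Submodule.mkQ_surjective _⟩
    refine Eff.del ?_ N hN ξ S ?_
    · have key : ∀ (C : Type u) [AddCommGroup C] [Module R C] (hC : Module.Finite R C),
          (∀ c : C, y • c = 0) → (∀ r ∈ p.asIdeal, ∀ c : C, r • c = 0) → Eff m C i := by
        intro C _ _ hC
        induction hC using IsNoetherianRing.induction_on_isQuotientEquivQuotientPrime R with
        | subsingleton N =>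
          intro _ _ N' _ _ hN' ξ
          refine ⟨N', _, _, LinearMap.id, hN', fun x => ⟨x, rfl⟩, ?_⟩
          rw [← push_id ξ, Subsingleton.elim (LinearMap.id : N →ₗ[R] N) ((0:R) • LinearMap.id),
            push_smul_id, zero_smul, map_zero]
        | quotient N q eq =>
          intro h1 h2
          refine Eff.equiv eq.symm ?_
          have h3 : ∀ r : R, (∀ c : N, r • c = 0) → r ∈ q.asIdeal := by
            intro r hr
            have := hr (eq.symm 1)
            rw [← map_smul, LinearEquiv.map_eq_zero_iff] at this
            rw [← Ideal.Quotient.eq_zero_iff_mem]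
            rw [Algebra.smul_def, mul_one] at this
            exact this
          have hlt : p < q := by
            refine lt_of_le_of_ne (fun r hr => h3 r (h2 r hr)) ?_
            rintro rfl
            exact hyp (h3 y h1)
          have hq : Order.coheight q + 1 ≤ e := (Order.coheight_add_one_le hlt).trans hp
          have he : e ≠ 0 := by
            rintro rfl
            simp at hq
          obtain ⟨e, rfl⟩ := Nat.exists_eq_succ_of_ne_zero he
          refine ih e (by omega) q ?_ i (by omega)
          push_cast at hq
          exact (ENat.add_le_add_iff_right (by simp)).1 hq
        | exact N₁ N₂ N₃ f g hf hg hfg ih1 ih3 =>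
          intro h1 h2
          refine Eff.ext ⟨hf, hfg, hg⟩ (ih1 ?_ ?_) (ih3 ?_ ?_)
          · intro c; apply hf; rw [map_smul, h1, map_zero]
          · intro r hr c; apply hf; rw [map_smul, h2 r hr, map_zero]
          · intro c; obtain ⟨c, rfl⟩ := hg c; rw [← map_smul, h1, map_zero]
          · intro r hr c; obtain ⟨c, rfl⟩ := hg c; rw [← map_smul, h2 r hr, map_zero]
      apply key _ inferInstance
      · intro c
        obtain ⟨c, rfl⟩ := Submodule.mkQ_surjective _ c
        rw [← map_smul, Submodule.mkQ_apply, Submodule.Quotient.mk_eq_zero]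
        exact ⟨c, rfl⟩
      · intro r hr c
        obtain ⟨c, rfl⟩ := Submodule.mkQ_surjective _ c
        rw [← map_smul, quot_smul_zero _ r hr, map_zero]
    · rw [push_smul_id]
      rw [← pull_id ξ, ← pull_smul]
      convert pull_zero _
      ext n
      exact hs y (Ideal.pow_mem_pow hx s) n

lemma eff_all [IsNoetherianRing R] [IsLocalRing R] (d : ℕ) (hd : ringKrullDim R = d)
    (M : Type u) [AddCommGroup M] [Module R M] (hM : Module.Finite R M) (i : ℕ) (hi : d < i) :
    Eff (IsLocalRing.maximalIdeal R) M i := by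
  induction hM using IsNoetherianRing.induction_on_isQuotientEquivQuotientPrime R with
  | subsingleton N =>
    intro N' _ _ hN' ξ
    refine ⟨N', _, _, LinearMap.id, hN', fun x => ⟨x, rfl⟩, ?_⟩
    rw [← push_id ξ, Subsingleton.elim (LinearMap.id : N →ₗ[R] N) ((0:R) • LinearMap.id),
      push_smul_id, zero_smul, map_zero]
  | quotient N p e =>
    refine Eff.equiv e.symm (eff_prime d p ?_ i hi)
    have := Order.coheight_le_krullDim p
    unfold ringKrullDim at hd
    rw [hd] at this
    exact_mod_cast this
  | exact N₁ N₂ N₃ f g hf hg hfg ih1 ih3 => exact Eff.ext ⟨hf, hfg, hg⟩ ih1 ih3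
end eff
end GorAux

namespace GorAux
open Abelian
section bass
/-- vanishing of Ext -/
def EV (A : Type u) [AddCommGroup A] [Module R A] (Y : Type u) [AddCommGroup Y] [Module R Y]
    (i : ℕ) : Prop := ∀ ξ : E R A Y i, ξ = 0
variable {R}
variable {A B C D : Type u} [AddCommGroup A] [Module R A] [AddCommGroup B] [Module R B]
  [AddCommGroup C] [Module R C] [AddCommGroup D] [Module R D]
  {Y : Type u} [AddCommGroup Y] [Module R Y] {i : ℕ}

lemma SES.cex₃ {f : A →ₗ[R] B} {g : B →ₗ[R] C} (h : SES f g) (ζ : E R D C i) (hζ : h.cdel ζ = 0) :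
    ∃ ξ : E R D B i, push g ξ = ζ :=
  Ext.covariant_sequence_exact₃ _ h.se ζ rfl hζ

lemma EV.equiv (e : A ≃ₗ[R] B) (h : EV R A Y i) : EV R B Y i := by
  intro ξ
  have := h (pull e.toLinearMap ξ)
  have h2 := congrArg (pull e.symm.toLinearMap) this
  rwa [pull_pull, LinearEquiv.comp_symm, pull_id, map_zero] at h2

lemma EV.mid {f : A →ₗ[R] B} {g : B →ₗ[R] C} (S : SES f g) (hA : EV R A Y i) (hC : EV R C Y i) :
    EV R B Y i := by
  intro ξ
  obtain ⟨ζ, rfl⟩ := S.ex₂ ξ (hA _)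
  rw [hC ζ, map_zero]

lemma EV_filt [IsNoetherianRing R] (J : Ideal R)
    (H : ∀ q : PrimeSpectrum R, J ≤ q.asIdeal → EV R (R ⧸ q.asIdeal) Y i) :
    ∀ (C : Type u) [AddCommGroup C] [Module R C] (hC : Module.Finite R C),
       (∀ r ∈ J, ∀ c : C, r • c = 0) → EV R C Y i := by
  intro C _ _ hC
  induction hC using IsNoetherianRing.induction_on_isQuotientEquivQuotientPrime R with
  | subsingleton N => intro _ ξ; exact E_subsing ξ
  | quotient N q eq =>
    intro h2
    refine EV.equiv eq.symm (H q ?_)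
    intro r hr
    have := h2 r hr (eq.symm 1)
    rw [← map_smul, LinearEquiv.map_eq_zero_iff] at this
    rw [← Ideal.Quotient.eq_zero_iff_mem]
    rw [Algebra.smul_def, mul_one] at this
    exact this
  | exact N₁ N₂ N₃ f g hf hg hfg ih1 ih3 =>
    intro h2
    refine EV.mid ⟨hf, hfg, hg⟩ (ih1 ?_) (ih3 ?_)
    · intro r hr c; apply hf; rw [map_smul, h2 r hr, map_zero]
    · intro r hr c; obtain ⟨c, rfl⟩ := hg c; rw [← map_smul, h2 r hr, map_zero]

lemma EV_FL [IsNoetherianRing R] [IsLocalRing R]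
    (hk : EV R (R ⧸ IsLocalRing.maximalIdeal R) Y i) (N : Type u) [AddCommGroup N] [Module R N]
    (hN : FL (IsLocalRing.maximalIdeal R) N) : EV R N Y i := by
  obtain ⟨h1, n, hn⟩ := hN
  refine EV_filt (IsLocalRing.maximalIdeal R ^ n) ?_ N h1 hn
  intro q hq
  have : q.asIdeal = IsLocalRing.maximalIdeal R :=
    le_antisymm (IsLocalRing.le_maximalIdeal q.2.ne_top) (q.2.le_of_pow_le hq)
  rw [this]; exact hk

lemma bass [IsNoetherianRing R] [IsLocalRing R] [Module.Finite R Y] (n : ℕ)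
    (hk : ∀ i > n, EV R (R ⧸ IsLocalRing.maximalIdeal R) Y i) :
    ∀ (p : Ideal R), p.IsPrime → ∀ i > n, EV R (R ⧸ p) Y i := by
  intro p
  induction p using WellFoundedGT.induction with
  | _ p ih =>
  intro hp i hi
  by_cases hpm : p = IsLocalRing.maximalIdeal R
  · rw [hpm]; exact hk i hi
  obtain ⟨x, hx, hxp⟩ : ∃ x ∈ IsLocalRing.maximalIdeal R, x ∉ p := by
    by_contra! h
    exact hpm (le_antisymm (IsLocalRing.le_maximalIdeal hp.ne_top) h)
  let f : (R ⧸ p) →ₗ[R] (R ⧸ p) := x • LinearMap.id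
  have hf : Function.Injective f := by
    rw [injective_iff_map_eq_zero]
    intro a ha
    obtain ⟨a, rfl⟩ := Ideal.Quotient.mk_surjective a
    have : x * a ∈ p := by
      rw [← Ideal.Quotient.eq_zero_iff_mem]; exact ha
    exact Ideal.Quotient.eq_zero_iff_mem.2 ((hp.mem_or_mem this).resolve_left hxp)
  have S : SES f (LinearMap.range f).mkQ :=
    ⟨hf, LinearMap.exact_map_mkQ_range f, Submodule.mkQ_surjective _⟩
  have hC : EV R ((R ⧸ p) ⧸ LinearMap.range f) Y (i+1) := by
    refine EV_filt (p ⊔ Ideal.span {x}) ?_ _ inferInstance ?_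
    · intro q hq
      refine ih q.asIdeal (lt_of_le_of_ne (le_sup_left.trans hq) ?_) q.2 (i+1) (by omega)
      intro h
      exact hxp (h ▸ hq (Ideal.mem_sup_right (Ideal.mem_span_singleton_self x)))
    · intro r hr c
      have : p ⊔ Ideal.span {x} ≤ Module.annihilator R ((R ⧸ p) ⧸ LinearMap.range f) := by
        refine sup_le ?_ ?_
        · intro r hr
          rw [Module.mem_annihilator]
          intro c
          obtain ⟨c, rfl⟩ := Submodule.mkQ_surjective _ c
          rw [← map_smul, quot_smul_zero _ r hr, map_zero]
        · rw [Ideal.span_singleton_le_iff_mem, Module.mem_annihilator]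
          intro c
          obtain ⟨c, rfl⟩ := Submodule.mkQ_surjective _ c
          rw [← map_smul, Submodule.mkQ_apply, Submodule.Quotient.mk_eq_zero]
          exact ⟨c, rfl⟩
      exact Module.mem_annihilator.1 (this hr) c
  have hfin : Module.Finite R (E R (R ⧸ p) Y i) := E_finite
  have hbot : (⊤ : Submodule R (E R (R ⧸ p) Y i)) = ⊥ := by
    refine Submodule.eq_bot_of_le_smul_of_le_jacobson_bot (IsLocalRing.maximalIdeal R) _ hfin.1 ?_
      (IsLocalRing.maximalIdeal_le_jacobson _)
    intro ξ _
    obtain ⟨η, rfl⟩ := S.ex₁ ξ (hC _)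
    rw [pull_smul, pull_id]
    exact Submodule.smul_mem_smul hx trivial
  intro ξ
  have : ξ ∈ (⊤ : Submodule R (E R (R ⧸ p) Y i)) := trivial
  rw [hbot] at this
  exact this

lemma bass_fg [IsNoetherianRing R] [IsLocalRing R] [Module.Finite R Y] (n : ℕ)
    (hk : ∀ i > n, EV R (R ⧸ IsLocalRing.maximalIdeal R) Y i) (N : Type u) [AddCommGroup N]
    [Module R N] [Module.Finite R N] (i : ℕ) (hi : n < i) : EV R N Y i :=
  EV_filt ⊥ (fun q _ => bass n hk q.asIdeal q.2 i hi) N inferInstance (by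
    intro r hr c
    rw [Ideal.mem_bot] at hr
    rw [hr, zero_smul])

noncomputable def hom0 (h : A →ₗ[R] Y) : E R A Y 0 := Ext.mk₀ (ModuleCat.ofHom h)
lemma hom0_surj (ξ : E R A Y 0) : ∃ h, hom0 h = ξ := by
  obtain ⟨h, rfl⟩ := Ext.homEquiv₀.symm.surjective ξ
  exact ⟨h.hom, rfl⟩
lemma hom0_inj (h h' : A →ₗ[R] Y) (e : hom0 h = hom0 h') : h = h' := by
  have := (Ext.homEquiv₀ (X := ModuleCat.of R A) (Y := ModuleCat.of R Y)).symm.injective e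
  exact ModuleCat.hom_ext_iff.1 this
lemma pull_hom0 (f : B →ₗ[R] A) (h : A →ₗ[R] Y) : pull f (hom0 h) = hom0 (h ∘ₗ f) := by
  rw [pull_def]; exact Ext.mk₀_comp_mk₀ _ _

lemma baer_ext (n : ℕ) : ∀ (M : Type u) [AddCommGroup M] [Module R M],
    (∀ I : Ideal R, EV R (R ⧸ I) M (n+1)) → ∀ (N : Type u) [AddCommGroup N] [Module R N],
      EV R N M (n+1) := by
  induction n with
  | zero =>
    intro M _ _ H N _ _
    have : Module.Baer R M := by
      intro I g
      obtain ⟨ξ, hξ⟩ := (SES.mkQ I).ex₁ (hom0 g) (H I _)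
      obtain ⟨h, rfl⟩ := hom0_surj ξ
      rw [pull_hom0] at hξ
      refine ⟨h, fun x hx => ?_⟩
      exact LinearMap.congr_fun (hom0_inj _ _ hξ) ⟨x, hx⟩
    have := this.injective
    intro ξ
    exact E_inj ξ
  | succ n ih =>
    intro M _ _ H N _ _
    obtain ⟨⟨I, hI, f, hf⟩⟩ := EnoughInjectives.presentation (ModuleCat.of R M)
    have : Module.Injective R I := Module.injective_module_of_injective_object R I
    have hf' : Function.Injective f.hom := (ModuleCat.mono_iff_injective _).1 hf
    let f' : M →ₗ[R] I := f.hom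
    have S : SES f' (LinearMap.range f').mkQ :=
      ⟨hf', LinearMap.exact_map_mkQ_range f', Submodule.mkQ_surjective _⟩
    have h1 : ∀ N : Type u, ∀ [AddCommGroup N] [Module R N], EV R N M (n+1+1) ↔ 
        EV R N (I ⧸ LinearMap.range f') (n+1) := by
      intro N _ _
      constructor
      · intro h ζ
        obtain ⟨ξ, rfl⟩ := S.cex₃ ζ (h _)
        rw [E_inj ξ, map_zero]
      · intro h ζ
        obtain ⟨η, rfl⟩ := S.cex₁ ζ (E_inj _)
        rw [h η, map_zero]
    exact (h1 N).2 (ih _ (fun J => (h1 _).1 (H J)) N)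

lemma all_of_k [IsNoetherianRing R] [IsLocalRing R] [Module.Finite R Y] (n : ℕ)
    (hk : ∀ i > n, EV R (R ⧸ IsLocalRing.maximalIdeal R) Y i) (N : Type u) [AddCommGroup N]
    [Module R N] (i : ℕ) (hi : n < i) : EV R N Y i := by
  obtain ⟨i, rfl⟩ := Nat.exists_eq_succ_of_ne_zero (show i ≠ 0 by omega)
  exact baer_ext i Y (fun I => bass_fg n hk _ _ hi) N
end bass
end GorAux

namespace GorAux
section findJ
variable {R}

lemma find_J_aux [IsNoetherianRing R] [IsLocalRing R] (n : ℕ) : ∀ (J : Ideal R) (t : ℕ), J ≠ ⊤ →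
    ringKrullDim (R ⧸ J) ≤ n →
    (∀ (Y : Type u) [AddCommGroup Y] [Module R Y], ∀ i > t, EV R (R ⧸ J) Y i) →
    ∃ (J : Ideal R) (t' : ℕ), t' ≤ t + n ∧
    (∀ (Y : Type u) [AddCommGroup Y] [Module R Y], ∀ i > t', EV R (R ⧸ J) Y i) ∧
    ∃ f : (R ⧸ IsLocalRing.maximalIdeal R) →ₗ[R] (R ⧸ J), Function.Injective f := by
  induction n using Nat.strong_induction_on with
  | _ n ih =>
  intro J t hJ hdim hEV
  by_cases hm : IsLocalRing.maximalIdeal R ∈ associatedPrimes R (R ⧸ J)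
  · rw [AssociatedPrimes.mem_iff, isAssociatedPrime_iff] at hm
    obtain ⟨_, x, hx⟩ := hm
    have hx' : ∀ r : R, r ∈ IsLocalRing.maximalIdeal R ↔ r • x = 0 := by
      intro r; rw [hx]; simp [Submodule.mem_colon_singleton]
    refine ⟨J, t, by omega, hEV, 
      Submodule.liftQ _ (LinearMap.toSpanSingleton R _ x) (fun r hr => (hx' r).1 hr), ?_⟩
    rw [injective_iff_map_eq_zero]
    intro a ha
    obtain ⟨r, rfl⟩ := Submodule.mkQ_surjective _ a
    exact (Submodule.Quotient.mk_eq_zero _).2 ((hx' r).2 ha)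
  · have h1 : ¬ ((IsLocalRing.maximalIdeal R : Set R) ⊆ ⋃ p ∈ associatedPrimes R (R ⧸ J), (id p : Ideal R)) := by
      rw [Ideal.subset_union_prime_finite (associatedPrimes.finite R (R ⧸ J)) (f := id) 0 0 fun _ h _ _ => h.1]
      rintro ⟨p, hp, hle⟩
      have : p = IsLocalRing.maximalIdeal R := 
        le_antisymm (IsLocalRing.le_maximalIdeal hp.1.ne_top) hle
      exact hm (this ▸ hp)
    simp only [id] at h1
    rw [biUnion_associatedPrimes_eq_zero_divisors, Set.not_subset] at h1
    obtain ⟨x, hx, hx2⟩ := h1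
    have hx3 : ∀ y : R ⧸ J, x • y = 0 → y = 0 := by
      intro y hy
      by_contra h
      exact hx2 ⟨y, h, hy⟩
    have hle : J ≤ J ⊔ Ideal.span {x} := le_sup_left
    have hJ' : J ⊔ Ideal.span {x} ≠ ⊤ := by
      intro h
      have : J ⊔ Ideal.span {x} ≤ IsLocalRing.maximalIdeal R :=
        sup_le (IsLocalRing.le_maximalIdeal hJ) (by rwa [Ideal.span_singleton_le_iff_mem])
      rw [h] at this
      exact (IsLocalRing.maximalIdeal.isMaximal R).ne_top (top_le_iff.1 this)
    have hd1 : ringKrullDim (R ⧸ (J ⊔ Ideal.span {x})) + 1 ≤ ringKrullDim (R ⧸ J) := by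
      refine ringKrullDim_succ_le_of_surjective (Ideal.Quotient.factor hle)
        (Ideal.Quotient.factor_surjective hle) (r := Ideal.Quotient.mk J x) ?_ ?_
      · rw [mem_nonZeroDivisors_iff_right]
        intro y hy
        refine hx3 y ?_
        rw [Algebra.smul_def, mul_comm]; exact hy
      · rw [Ideal.Quotient.factor_mk, Ideal.Quotient.eq_zero_iff_mem]
        exact Ideal.mem_sup_right (Ideal.mem_span_singleton_self x)
    have hnt : Nontrivial (R ⧸ (J ⊔ Ideal.span {x})) := Ideal.Quotient.nontrivial_iff.2 hJ'
    have h0 : 0 ≤ ringKrullDim (R ⧸ (J ⊔ Ideal.span {x})) := ringKrullDim_nonneg_of_nontrivial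
    let f : (R ⧸ J) →ₗ[R] (R ⧸ J) := x • LinearMap.id
    let g : (R ⧸ J) →ₗ[R] (R ⧸ (J ⊔ Ideal.span {x})) := Submodule.mapQ _ _ LinearMap.id hle
    have S : SES f g := by
      refine ⟨?_, ?_, ?_⟩
      · rw [injective_iff_map_eq_zero]
        intro y hy
        exact hx3 y hy
      · intro y
        obtain ⟨a, rfl⟩ := Submodule.mkQ_surjective _ y
        have : g (Submodule.mkQ J a) = Submodule.mkQ (J ⊔ Ideal.span {x}) a := rfl
        rw [this, Submodule.mkQ_apply, Submodule.Quotient.mk_eq_zero, Submodule.mem_sup]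
        constructor
        · rintro ⟨j, hj, z, hz, rfl⟩
          obtain ⟨r, rfl⟩ := Ideal.mem_span_singleton'.1 hz
          refine ⟨Submodule.mkQ J r, ?_⟩
          rw [map_add, (Submodule.Quotient.mk_eq_zero J).2 hj |> fun h => (h : Submodule.mkQ J j = 0), zero_add, mul_comm]
          rfl
        · rintro ⟨y, hy⟩
          obtain ⟨r, rfl⟩ := Submodule.mkQ_surjective _ y
          have : Submodule.mkQ J (x * r) = Submodule.mkQ J a := hy
          rw [Submodule.mkQ_apply, Submodule.mkQ_apply, Submodule.Quotient.eq] at this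
          refine ⟨a - x * r, ?_, x * r, Ideal.mem_span_singleton'.2 ⟨r, mul_comm _ _⟩, by ring⟩
          rw [← neg_sub]; exact J.neg_mem this
      · intro y
        obtain ⟨a, rfl⟩ := Submodule.mkQ_surjective _ y
        exact ⟨Submodule.mkQ J a, rfl⟩
    have hEV' : ∀ (Y : Type u) [AddCommGroup Y] [Module R Y], ∀ i > t + 1, 
        EV R (R ⧸ (J ⊔ Ideal.span {x})) Y i := by
      intro Y _ _ i hi ζ
      obtain ⟨i, rfl⟩ := Nat.exists_eq_succ_of_ne_zero (show i ≠ 0 by omega)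
      obtain ⟨η, rfl⟩ := S.ex₃ ζ (hEV Y _ (by omega) _)
      rw [hEV Y i (by omega) η, map_zero]
    have h2 := hd1.trans hdim
    cases n with
    | zero => 
      exfalso
      have h3 : (0 : WithBot ℕ∞) + 1 ≤ 0 := (add_le_add_left h0 1).trans h2
      exact absurd h3 (by decide)
    | succ n =>
      obtain ⟨J', t', h1, h2, h3⟩ := ih n (by omega) _ (t+1) hJ' (by
        push_cast at h2
        revert h2
        generalize ringKrullDim (R ⧸ (J ⊔ Ideal.span {x})) = a
        intro h2
        induction a with
        | bot => exact bot_le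
        | coe a =>
          have h3 : a + 1 ≤ (n : ℕ∞) + 1 := by exact_mod_cast h2
          have h4 : a ≤ (n : ℕ∞) := (ENat.add_le_add_iff_right (by simp)).1 h3
          exact_mod_cast h4) hEV'
      exact ⟨J', t', by omega, h2, h3⟩

lemma find_J [IsNoetherianRing R] [IsLocalRing R] (d : ℕ) (hd : ringKrullDim R = d) :
    ∃ (J : Ideal R), 
    (∀ (Y : Type u) [AddCommGroup Y] [Module R Y], ∀ i > d, EV R (R ⧸ J) Y i) ∧
    ∃ f : (R ⧸ IsLocalRing.maximalIdeal R) →ₗ[R] (R ⧸ J), Function.Injective f := by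
  obtain ⟨J, t, h1, h2, h3⟩ := find_J_aux d (⊥ : Ideal R) 0 bot_ne_top
    (by rw [ringKrullDim_eq_of_ringEquiv (RingEquiv.quotientBot R), hd]) (by
      intro Y _ _ i hi
      obtain ⟨i, rfl⟩ := Nat.exists_eq_succ_of_ne_zero (show i ≠ 0 by omega)
      refine EV.equiv (Submodule.quotEquivOfEqBot (⊥ : Ideal R) rfl).symm ?_
      intro ξ
      exact E_proj ξ)
  exact ⟨J, fun Y _ _ i hi => h2 Y i (by omega), h3⟩

lemma descend [IsNoetherianRing R] [IsLocalRing R] (d : ℕ) (hd : ringKrullDim R = d)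
    (M : Type u) [AddCommGroup M] [Module R M] [Module.Finite R M] (n : ℕ)
    (hn : ∀ i > n, EV R (R ⧸ IsLocalRing.maximalIdeal R) M i) :
    ∀ i > d, EV R (R ⧸ IsLocalRing.maximalIdeal R) M i := by
  obtain ⟨J, hJ, f, hf⟩ := find_J d hd
  induction n with
  | zero => exact fun i hi => hn i (by omega)
  | succ n ih =>
    by_cases h : d < n + 1
    · apply ih
      intro i hi
      by_cases h' : n + 1 < i
      · exact hn i h'
      · obtain rfl : i = n + 1 := by omega
        have S : SES f (LinearMap.range f).mkQ :=
          ⟨hf, LinearMap.exact_map_mkQ_range f, Submodule.mkQ_surjective _⟩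
        intro ξ
        obtain ⟨η, rfl⟩ := S.ex₁ ξ (bass_fg (n+1) hn _ _ (by omega) _)
        rw [hJ M (n+1) h η, map_zero]
    · exact fun i hi => hn i (by omega)
end findJ
end GorAux

namespace GorAux
section art
variable {R}

lemma art_one {H : Type u} [AddCommGroup H] [Module R H] (y : R)
    (ht : ∀ h : H, ∃ n : ℕ, y ^ n • h = 0) (P : Submodule R H) (hP : ∀ h, h ∈ P ↔ y • h = 0)
    [IsArtinian R P] : IsArtinian R H := by
  rw [← monotone_stabilizes_iff_artinian]
  intro N
  let K : ℕ → Submodule R H → Submodule R P := fun i N =>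
    (N.map (y ^ i • (LinearMap.id : H →ₗ[R] H))).comap P.subtype
  have hK : ∀ i N (p : P), p ∈ K i N ↔ ∃ h ∈ N, y ^ i • h = (p : H) := fun i N p => Iff.rfl
  let Nj : ℕ → Submodule R H := fun j => OrderDual.ofDual (N j)
  have hN : ∀ j j', j ≤ j' → Nj j' ≤ Nj j := fun j j' h => N.monotone h
  have hKN : ∀ i (N N' : Submodule R H), N ≤ N' → K i N ≤ K i N' := by
    intro i N N' h p hp
    rw [hK] at hp ⊢
    obtain ⟨z, hz, e⟩ := hp
    exact ⟨z, h hz, e⟩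
  have hKi : ∀ (N : Submodule R H) i i', i ≤ i' → K i' N ≤ K i N := by
    intro N i i' h p hp
    rw [hK] at hp ⊢
    obtain ⟨z, hz, e⟩ := hp
    refine ⟨y ^ (i' - i) • z, N.smul_mem _ hz, ?_⟩
    rw [smul_smul, ← pow_add, Nat.add_sub_cancel' h, e]
  have stab : ∀ F : ℕ → Submodule R P, (∀ j j', j ≤ j' → F j' ≤ F j) → ∃ n, ∀ m ≥ n, F n = F m := by
    intro F hF
    obtain ⟨n, hn⟩ := monotone_stabilizes_iff_artinian.2 ‹IsArtinian R P›
      ⟨fun j => OrderDual.toDual (F j), fun j j' h => hF j j' h⟩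
    exact ⟨n, fun m hm => hn m hm⟩
  obtain ⟨n0, hn0⟩ := stab (fun n => K n (Nj n))
    (fun j j' h => (hKi _ _ _ h).trans (hKN _ _ _ (hN _ _ h)))
  choose J hJ using fun i => stab (fun j => K i (Nj j)) (fun j j' h => hKN _ _ _ (hN _ _ h))
  let T := n0 + ∑ i ∈ Finset.range n0, J i
  have hT : ∀ t ≥ T, ∀ i, K i (Nj T) ≤ K i (Nj t) := by
    intro t ht i
    by_cases hi : i < n0
    · have h1 : J i ≤ T := (Finset.single_le_sum (f := J) (fun _ _ => Nat.zero_le _)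
        (Finset.mem_range.2 hi)).trans (Nat.le_add_left _ _)
      exact le_of_eq ((hJ i T h1).symm.trans (hJ i t (h1.trans ht)))
    · have h1 : n0 ≤ T := Nat.le_add_right _ _
      calc K i (Nj T) ≤ K n0 (Nj T) := hKi _ _ _ (by omega)
        _ ≤ K n0 (Nj n0) := hKN _ _ _ (hN _ _ h1)
        _ = K (max i t) (Nj (max i t)) := hn0 _ (by omega)
        _ ≤ K (max i t) (Nj t) := hKN _ _ _ (hN _ _ (le_max_right _ _))
        _ ≤ K i (Nj t) := hKi _ _ _ (le_max_left _ _)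
  refine ⟨T, fun t ht' => ?_⟩
  change Nj T = Nj t
  refine le_antisymm ?_ (hN _ _ ht')
  have key : ∀ i : ℕ, ∀ h ∈ Nj T, y ^ i • h = 0 → h ∈ Nj t := by
    intro i
    induction i with
    | zero => intro h _ e; rw [pow_zero, one_smul] at e; rw [e]; exact zero_mem _
    | succ i ih =>
      intro h hh e
      have hp : y ^ i • h ∈ P := by rw [hP, smul_smul, ← pow_succ', e]
      have h1 : (⟨_, hp⟩ : P) ∈ K i (Nj T) := (hK _ _ _).2 ⟨h, hh, rfl⟩
      obtain ⟨h', hh', e'⟩ := (hK _ _ _).1 (hT t ht' i h1)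
      have h2 := ih (h - h') (sub_mem hh (hN _ _ ht' hh')) (by rw [smul_sub, e', sub_self])
      have := add_mem h2 hh'
      rwa [sub_add_cancel] at this
  intro h hh
  obtain ⟨n, hn⟩ := ht h
  exact key n h hh hn

lemma art_list (s : List R) : ∀ {H : Type u} [AddCommGroup H] [Module R H]
    (_ : ∀ y ∈ s, ∀ h : H, ∃ n : ℕ, y ^ n • h = 0) (P : Submodule R H)
    (_ : ∀ h, h ∈ P ↔ ∀ y ∈ s, y • h = 0) [IsArtinian R P], IsArtinian R H := by
  induction s with
  | nil =>
    intro H _ _ _ P hP _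
    have : P = ⊤ := by rw [eq_top_iff]; intro h _; rw [hP]; simp
    subst this
    exact isArtinian_of_linearEquiv (Submodule.topEquiv (R := R) (M := H))
  | cons y s ih =>
    intro H _ _ ht P hP _
    let Q : Submodule R H := LinearMap.ker (y • (LinearMap.id : H →ₗ[R] H))
    have hQ : ∀ h, h ∈ Q ↔ y • h = 0 := fun h => Iff.rfl
    have hPQ : P ≤ Q := by
      intro h hh
      rw [hQ]
      exact (hP h).1 hh y (by simp)
    have : IsArtinian R Q := by
      have hart : IsArtinian R (P.comap Q.subtype) :=
        isArtinian_of_linearEquiv (Submodule.comapSubtypeEquivOfLe hPQ).symm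
      refine ih ?_ (P.comap Q.subtype) ?_
      · intro z hz h
        obtain ⟨n, hn⟩ := ht z (List.mem_cons_of_mem _ hz) h
        exact ⟨n, Subtype.ext hn⟩
      · intro h
        rw [Submodule.mem_comap, hP]
        constructor
        · intro h1 z hz
          exact Subtype.ext (h1 z (List.mem_cons_of_mem _ hz))
        · intro h1 z hz
          rcases List.mem_cons.1 hz with rfl | hz
          · exact h.2
          · exact congrArg Subtype.val (h1 z hz)
    exact art_one y (ht y (by simp)) Q hQ

lemma art_main [IsNoetherianRing R] (I : Ideal R) {H : Type u} [AddCommGroup H] [Module R H]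
    (ht : ∀ h : H, ∃ n : ℕ, ∀ r ∈ I ^ n, r • h = 0) (P : Submodule R H)
    (hP : ∀ h, h ∈ P ↔ ∀ r ∈ I, r • h = 0) [IsArtinian R P] : IsArtinian R H := by
  obtain ⟨s, hs⟩ := (isNoetherianRing_iff_ideal_fg R).1 inferInstance I
  refine art_list s.toList ?_ P ?_
  · intro y hy h
    obtain ⟨n, hn⟩ := ht h
    refine ⟨n, hn _ (Ideal.pow_mem_pow ?_ n)⟩
    rw [← hs]; exact Ideal.subset_span (by simpa using hy)
  · intro h
    rw [hP]
    constructor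
    · intro h1 y hy
      exact h1 y (by rw [← hs]; exact Ideal.subset_span (by simpa using hy))
    · intro h1 r hr
      rw [← hs] at hr
      have : Ideal.span (s : Set R) ≤ LinearMap.ker (LinearMap.toSpanSingleton R H h) := by
        rw [Ideal.span_le]
        intro y hy
        exact h1 y (by simpa using hy)
      exact this hr
end art
end GorAux

namespace GorAux
section s5
variable {R}
variable {A B C N : Type u} [AddCommGroup A] [Module R A] [AddCommGroup B] [Module R B]
  [AddCommGroup C] [Module R C] [AddCommGroup N] [Module R N]
  {M : Type u} [AddCommGroup M] [Module R M] {d : ℕ}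

lemma FL.sub [IsNoetherianRing R] {I : Ideal R} (f : A →ₗ[R] B) (hf : Function.Injective f)
    (h : FL I B) : FL I A := by
  obtain ⟨h1, n, hn⟩ := h
  refine ⟨Module.Finite.of_injective f hf, n, fun r hr a => hf ?_⟩
  rw [map_smul, hn r hr, map_zero]

lemma FL.quot {I : Ideal R} (f : A →ₗ[R] B) (hf : Function.Surjective f)
    (h : FL I A) : FL I B := by
  obtain ⟨h1, n, hn⟩ := h
  refine ⟨Module.Finite.of_surjective f hf, n, fun r hr a => ?_⟩
  obtain ⟨a, rfl⟩ := hf a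
  rw [← map_smul, hn r hr, map_zero]

lemma FL_pow (I : Ideal R) (n : ℕ) : FL I (R ⧸ I ^ n) :=
  ⟨inferInstance, n, fun r hr a => quot_smul_zero _ r hr a⟩

/-- one in the quotient -/
def q1 (J : Ideal R) : R ⧸ J := Submodule.mkQ J 1

lemma q1_smul (J : Ideal R) (r : R) : r • q1 J = Submodule.mkQ J r := by
  rw [q1, ← map_smul, smul_eq_mul, mul_one]

lemma q1_exists (J : Ideal R) (y : R ⧸ J) : ∃ r : R, r • q1 J = y := by
  obtain ⟨r, rfl⟩ := Submodule.mkQ_surjective _ y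
  exact ⟨r, q1_smul J r⟩

lemma q1_zero (J : Ideal R) (r : R) : r • q1 J = 0 ↔ r ∈ J := by
  rw [q1_smul]; exact Submodule.Quotient.mk_eq_zero J

lemma hom_q1 {J : Ideal R} {f g : (R ⧸ J) →ₗ[R] N} (h : f (q1 J) = g (q1 J)) : f = g := by
  ext
  exact h

/-- the map sending `1` to `x` -/
def cx (J : Ideal R) (x : N) (hx : ∀ r ∈ J, r • x = 0) : (R ⧸ J) →ₗ[R] N :=
  Submodule.liftQ J (LinearMap.toSpanSingleton R N x) (fun r hr => hx r hr)

lemma cx_q1 (J : Ideal R) (x : N) (hx : ∀ r ∈ J, r • x = 0) : cx J x hx (q1 J) = x := by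
  have : cx J x hx (q1 J) = (1 : R) • x := rfl
  rw [this, one_smul]

lemma exists_pi [Module.Finite R N] (J : Ideal R) (hN : ∀ r ∈ J, ∀ x : N, r • x = 0) :
    ∃ (s : ℕ) (x : Fin s → N) (p : (Fin s → R ⧸ J) →ₗ[R] N), Function.Surjective p ∧
      p = ∑ i, cx J (x i) (fun r hr => hN r hr _) ∘ₗ LinearMap.proj i := by
  obtain ⟨s, x, hx⟩ := Module.Finite.exists_fin (R := R) (M := N)
  refine ⟨s, x, _, ?_, rfl⟩
  intro n
  have : n ∈ Submodule.span R (Set.range x) := by rw [hx]; trivial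
  obtain ⟨c, rfl⟩ := (Submodule.mem_span_range_iff_exists_fun R).1 this
  refine ⟨fun i => c i • q1 J, ?_⟩
  rw [LinearMap.sum_apply]
  refine Finset.sum_congr rfl fun i _ => ?_
  rw [LinearMap.comp_apply, LinearMap.proj_apply, map_smul, cx_q1]

lemma FL_pi (I : Ideal R) (n s : ℕ) : FL I (Fin s → R ⧸ I ^ n) :=
  ⟨inferInstance, n, fun r hr a => funext fun i => quot_smul_zero _ r hr (a i)⟩

variable [IsNoetherianRing R] [IsLocalRing R]
local notation "𝔪" => IsLocalRing.maximalIdeal R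

lemma pull_inj (hlow : ∀ i < d, EV R (R ⧸ 𝔪) M i) (g : B →ₗ[R] C) (hg : Function.Surjective g)
    (hB : FL 𝔪 B) (ξ : E R C M d) (h : pull g ξ = 0) : ξ = 0 := by
  cases d with
  | zero => exact E_zero_inj g hg ξ h
  | succ e =>
    obtain ⟨η, rfl⟩ := (SES.ker g hg).ex₃ ξ h
    rw [EV_FL (hlow e (by omega)) _ (hB.sub (LinearMap.ker g).subtype Subtype.val_injective) η, map_zero]

lemma phi_inj (hlow : ∀ i < d, EV R (R ⧸ 𝔪) M i) (n : ℕ) [Module.Finite R N]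
    (hN : ∀ r ∈ 𝔪 ^ n, ∀ x : N, r • x = 0) (ξ : E R N M d)
    (h : ∀ f : (R ⧸ 𝔪 ^ n) →ₗ[R] N, pull f ξ = 0) : ξ = 0 := by
  obtain ⟨s, x, p, hp, e⟩ := exists_pi (𝔪 ^ n) hN
  refine pull_inj hlow p hp (FL_pi _ n s) ξ ?_
  rw [e, pull_sum]
  refine Finset.sum_eq_zero fun i _ => ?_
  rw [← pull_pull, h, map_zero]

lemma phi_surj (hlow : ∀ i < d, EV R (R ⧸ 𝔪) M i) (n : ℕ) [Module.Finite R N]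
    (hN : ∀ r ∈ 𝔪 ^ n, ∀ x : N, r • x = 0) (g : N →ₗ[R] E R (R ⧸ 𝔪 ^ n) M d) :
    ∃ ξ : E R N M d, ∀ f : (R ⧸ 𝔪 ^ n) →ₗ[R] N, pull f ξ = g (f (q1 _)) := by
  obtain ⟨s, x, p, hp, e⟩ := exists_pi (𝔪 ^ n) hN
  let ζ : E R (Fin s → R ⧸ 𝔪 ^ n) M d := ∑ i, pull (LinearMap.proj i) (g (x i))
  have key : ∀ f : (R ⧸ 𝔪 ^ n) →ₗ[R] (Fin s → R ⧸ 𝔪 ^ n), pull f ζ = g (p (f (q1 _))) := by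
    intro f
    choose c hc using fun i => q1_exists (𝔪 ^ n) (f (q1 _) i)
    have h1 : p (f (q1 _)) = ∑ i, c i • x i := by
      rw [e, LinearMap.sum_apply]
      refine Finset.sum_congr rfl fun i _ => ?_
      rw [LinearMap.comp_apply, LinearMap.proj_apply, ← hc, map_smul, cx_q1]
    rw [h1, map_sum, map_sum]
    refine Finset.sum_congr rfl fun i _ => ?_
    have h2 : (LinearMap.proj i : (Fin s → R ⧸ 𝔪 ^ n) →ₗ[R] _) ∘ₗ f = c i • LinearMap.id :=
      hom_q1 (hc i).symm
    rw [pull_pull, h2, pull_smul, pull_id, map_smul]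
  have S := SES.ker p hp
  have h0 : pull (LinearMap.ker p).subtype ζ = 0 := by
    refine phi_inj hlow n (N := LinearMap.ker p) ?_ _ ?_
    · intro r hr x
      exact Subtype.ext (funext fun i => quot_smul_zero _ r hr (x.1 i))
    · intro f
      rw [pull_pull, key]
      have : p (((LinearMap.ker p).subtype ∘ₗ f) (q1 _)) = 0 := (f (q1 _)).2
      rw [this, map_zero]
  obtain ⟨ξ, hξ⟩ := S.ex₂ ζ h0
  refine ⟨ξ, fun f => ?_⟩
  obtain ⟨y, hy⟩ := hp (f (q1 _))
  let f' : (R ⧸ 𝔪 ^ n) →ₗ[R] (Fin s → R ⧸ 𝔪 ^ n) :=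
    cx _ y (fun r hr => funext fun i => quot_smul_zero _ r hr (y i))
  have hf : f = p ∘ₗ f' := hom_q1 (by rw [LinearMap.comp_apply, cx_q1, hy])
  rw [hf, ← pull_pull, hξ, key]; rfl

variable {H : Type u} [AddCommGroup H] [Module R H]

lemma ι_inj (hlow : ∀ i < d, EV R (R ⧸ 𝔪) M i) (c : ColimData 𝔪 (ModuleCat.of R M) d H) (n : ℕ) :
    Function.Injective (c.ι n) := by
  rw [injective_iff_map_eq_zero]
  intro ξ h
  obtain ⟨l, hl, e⟩ := c.ker n ξ h
  refine pull_inj hlow (Submodule.mapQ _ _ LinearMap.id (Ideal.pow_le_pow_right hl)) ?_ (FL_pow _ l) ξ e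
  intro y
  obtain ⟨a, rfl⟩ := Submodule.mkQ_surjective _ y
  exact ⟨Submodule.mkQ _ a, rfl⟩

lemma E_killed {J : Ideal R} (r : R) (hr : r ∈ J) (ξ : E R (R ⧸ J) M d) : r • ξ = 0 := by
  rw [← pull_id ξ, ← pull_smul]
  convert pull_zero ξ
  refine LinearMap.ext fun y => ?_
  exact quot_smul_zero J r hr y

lemma H_tors (c : ColimData 𝔪 (ModuleCat.of R M) d H) (h : H) : ∃ n, ∀ r ∈ 𝔪 ^ n, r • h = 0 := by
  obtain ⟨n, ξ, rfl⟩ := c.surj h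
  refine ⟨n, fun r hr => ?_⟩
  rw [← map_smul, E_killed r hr ξ, map_zero]

lemma ι_range (hlow : ∀ i < d, EV R (R ⧸ 𝔪) M i) (c : ColimData 𝔪 (ModuleCat.of R M) d H) (j : ℕ)
    (h : H) (hh : ∀ r ∈ 𝔪 ^ j, r • h = 0) : ∃ ζ, c.ι j ζ = h := by
  obtain ⟨n, ξ, rfl⟩ : ∃ n, ∃ ξ, c.ι (n + j) ξ = h := by
    obtain ⟨n, ξ, rfl⟩ := c.surj h
    exact ⟨n, _, c.compat n (n + j) (by omega) ξ⟩
  have hξ : ∀ r ∈ 𝔪 ^ j, r • ξ = 0 := by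
    intro r hr
    apply ι_inj hlow c
    rw [map_smul, hh r hr, map_zero]
  let q : (R ⧸ 𝔪 ^ (n + j)) →ₗ[R] (R ⧸ 𝔪 ^ j) :=
    Submodule.mapQ _ _ LinearMap.id (Ideal.pow_le_pow_right (by omega))
  have hq : Function.Surjective q := by
    intro y
    obtain ⟨a, rfl⟩ := Submodule.mkQ_surjective _ y
    exact ⟨Submodule.mkQ _ a, rfl⟩
  have S := SES.ker q hq
  obtain ⟨ζ, hζ⟩ := S.ex₂ (Y := M) (i := d) ξ (by
    refine phi_inj hlow (n + j) (N := LinearMap.ker q) ?_ _ ?_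
    · intro r hr x
      exact Subtype.ext (quot_smul_zero _ r hr x.1)
    · intro f
      rw [pull_pull]
      obtain ⟨r, hr⟩ := q1_exists _ ((f (q1 _)).1)
      have h1 : (LinearMap.ker q).subtype ∘ₗ f = r • LinearMap.id := hom_q1 hr.symm
      have h2 : q (f (q1 _)).1 = 0 := (f (q1 _)).2
      rw [← hr, map_smul] at h2
      have h3 : r ∈ 𝔪 ^ j := (q1_zero _ r).1 h2
      rw [h1, pull_smul, pull_id]
      exact hξ r h3)
  refine ⟨ζ, ?_⟩
  rw [← hζ]
  exact (c.compat j (n + j) (by omega) ζ).symm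

lemma artinian_H [Module.Finite R M] (hlow : ∀ i < d, EV R (R ⧸ 𝔪) M i) (c : ColimData 𝔪 (ModuleCat.of R M) d H) :
    IsArtinian R H := by
  let P : Submodule R H :=
    { carrier := {h | ∀ r ∈ 𝔪 ^ 1, r • h = 0}
      add_mem' := by
        intro a b ha hb r hr
        rw [smul_add, ha r hr, hb r hr, add_zero]
      zero_mem' := by intro r _; exact smul_zero r
      smul_mem' := by
        intro t a ha r hr
        rw [smul_comm, ha r hr, smul_zero] }
  have hP : ∀ h, h ∈ P ↔ ∀ r ∈ 𝔪 ^ 1, r • h = 0 := fun h => Iff.rfl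
  have hfin : Module.Finite R (E R (R ⧸ 𝔪 ^ 1) M d) := E_finite
  have hPr : P ≤ LinearMap.range (c.ι 1) := by
    intro h hh
    exact ι_range hlow c 1 h hh
  have hPfin : Module.Finite R P :=
    Module.Finite.of_injective (Submodule.inclusion hPr) (Submodule.inclusion_injective hPr)
  obtain ⟨s, x, p, hp, -⟩ := exists_pi (N := P) (𝔪 ^ 1) (fun r hr x => Subtype.ext (x.2 r hr))
  have hk : IsArtinian R (R ⧸ 𝔪 ^ 1) := by
    rw [pow_one]
    let _ := Ideal.Quotient.field 𝔪
    have : IsArtinian (R ⧸ 𝔪) (R ⧸ 𝔪) := inferInstance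
    exact isArtinian_of_surjective_algebraMap (S := R) (Ideal.Quotient.mk_surjective (I := 𝔪))
  have : IsArtinian R P := isArtinian_of_surjective (Fin s → R ⧸ 𝔪 ^ 1) p hp
  refine art_main 𝔪 (H_tors c) P ?_
  intro h
  rw [hP, pow_one]
end s5
end GorAux

namespace GorAux
section s7
variable {R}
variable {A B C N : Type u} [AddCommGroup A] [Module R A] [AddCommGroup B] [Module R B]
  [AddCommGroup C] [Module R C] [AddCommGroup N] [Module R N]
  {M : Type u} [AddCommGroup M] [Module R M] {d : ℕ}

lemma SES.del_pull {f : A →ₗ[R] B} {g : B →ₗ[R] C} (S : SES f g) (ζ : E R B M d) :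
    S.del (pull f ζ) = 0 := by
  have S' : SES (LinearMap.id : B →ₗ[R] B) (0 : B →ₗ[R] PUnit.{u+1}) :=
    ⟨fun _ _ h => h, fun y => ⟨fun _ => ⟨y, rfl⟩, fun _ => rfl⟩, fun _ => ⟨0, rfl⟩⟩
  rw [← S.nat S' f LinearMap.id 0 rfl rfl ζ, pull_zero]

variable [IsNoetherianRing R] [IsLocalRing R]
local notation "𝔪" => IsLocalRing.maximalIdeal R
variable {H : Type u} [AddCommGroup H] [Module R H]

lemma unif_tors (c : ColimData 𝔪 (ModuleCat.of R M) d H) [Module.Finite R N] (f : N →ₗ[R] H) :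
    ∃ j, ∀ r ∈ 𝔪 ^ j, ∀ x, r • f x = 0 := by
  obtain ⟨s, x, hx⟩ := Module.Finite.exists_fin (R := R) (M := N)
  choose n hn using fun i => H_tors c (f (x i))
  refine ⟨∑ i, n i, fun r hr y => ?_⟩
  have : y ∈ Submodule.span R (Set.range x) := by rw [hx]; trivial
  obtain ⟨a, rfl⟩ := (Submodule.mem_span_range_iff_exists_fun R).1 this
  rw [map_sum, Finset.smul_sum]
  refine Finset.sum_eq_zero fun i _ => ?_
  have h1 : n i ≤ ∑ i, n i := Finset.single_le_sum (f := n) (fun _ _ => Nat.zero_le _) (Finset.mem_univ i)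
  rw [map_smul, smul_comm, hn i r (Ideal.pow_le_pow_right h1 hr), smul_zero]

lemma injective_H (hlow : ∀ i < d, EV R (R ⧸ 𝔪) M i)
    (c : ColimData 𝔪 (ModuleCat.of R M) d H) (hd1 : EV R (R ⧸ 𝔪) M (d+1)) : Module.Injective R H := by
  apply Module.Baer.injective
  intro I f
  obtain ⟨j, hj⟩ := unif_tors c f
  obtain ⟨n, hnj, hn⟩ := artin_rees 𝔪 I j
  have hfI : ∀ x : I, (x : R) ∈ 𝔪 ^ n → f x = 0 := by
    intro x hx
    have h1 := hn n le_rfl x (by rwa [smul_eq_mul, Ideal.mul_top])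
    have h2 : 𝔪 ^ j • (⊤ : Submodule R I) ≤ LinearMap.ker f := by
      rw [Submodule.smul_le]
      intro r hr y _
      rw [LinearMap.mem_ker, map_smul, hj r hr]
    exact h2 h1
  let ψ : I →ₗ[R] (R ⧸ 𝔪 ^ n) := Submodule.mkQ (𝔪 ^ n) ∘ₗ I.subtype
  have hψ : ∀ x : I, ψ x = (x : R) • q1 (𝔪 ^ n) := fun x => (q1_smul _ _).symm
  have inj := ι_inj hlow c n
  let e := LinearEquiv.ofInjective (c.ι n) inj
  have hr : ∀ x, f x ∈ LinearMap.range (c.ι n) := fun x =>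
    ι_range hlow c n (f x) (fun r hr => hj r (Ideal.pow_le_pow_right hnj hr) x)
  let fQ : I →ₗ[R] E R (R ⧸ 𝔪 ^ n) M d := e.symm.toLinearMap ∘ₗ f.codRestrict _ hr
  have hfQ : ∀ x, c.ι n (fQ x) = f x := by
    intro x
    exact congrArg Subtype.val (e.apply_symm_apply (f.codRestrict _ hr x))
  let g : (I ⧸ LinearMap.ker ψ) →ₗ[R] E R (R ⧸ 𝔪 ^ n) M d := Submodule.liftQ _ fQ (by
    intro x hx
    rw [LinearMap.mem_ker] at hx ⊢
    apply inj
    rw [hfQ, map_zero]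
    apply hfI
    rw [hψ, q1_zero] at hx
    exact hx)
  let inc : (I ⧸ LinearMap.ker ψ) →ₗ[R] (R ⧸ 𝔪 ^ n) := Submodule.liftQ _ ψ le_rfl
  have hinc : Function.Injective inc := by
    rw [← LinearMap.ker_eq_bot]
    exact Submodule.ker_liftQ_eq_bot _ _ _ le_rfl
  have hkill : ∀ r ∈ 𝔪 ^ n, ∀ x : I ⧸ LinearMap.ker ψ, r • x = 0 := by
    intro r hr x
    apply hinc
    rw [map_smul, quot_smul_zero _ r hr, map_zero]
  obtain ⟨ξ, hξ⟩ := phi_surj hlow n hkill g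
  have S : SES inc (LinearMap.range inc).mkQ :=
    ⟨hinc, LinearMap.exact_map_mkQ_range inc, Submodule.mkQ_surjective _⟩
  obtain ⟨ζ, rfl⟩ := S.ex₁ ξ (EV_FL hd1 _ ((FL_pow _ n).quot _ (Submodule.mkQ_surjective _)) _)
  refine ⟨LinearMap.toSpanSingleton R H (c.ι n ζ), fun x hx => ?_⟩
  let x' : I := ⟨x, hx⟩
  let y : I ⧸ LinearMap.ker ψ := Submodule.mkQ _ x'
  have h1 := hξ (cx _ y (fun r hr => hkill r hr y))
  have h2 : inc ∘ₗ (cx _ y (fun r hr => hkill r hr y)) = x • LinearMap.id := by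
    apply hom_q1
    rw [LinearMap.comp_apply, cx_q1]
    exact hψ x'
  rw [pull_pull, h2, pull_smul, pull_id, cx_q1] at h1
  have h3 : g y = fQ x' := rfl
  rw [LinearMap.toSpanSingleton_apply, ← map_smul]
  refine (congrArg (c.ι n) h1).trans ?_
  rw [h3, hfQ]

lemma ext_of_inj (hlow : ∀ i < d, EV R (R ⧸ 𝔪) M i)
    (c : ColimData 𝔪 (ModuleCat.of R M) d H) (hH : Module.Injective R H) (n : ℕ)
    (A : Submodule R (R ⧸ 𝔪 ^ n)) (ξ : E R A M d) : ∃ ζ : E R (R ⧸ 𝔪 ^ n) M d, pull A.subtype ζ = ξ := by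
  have hkill : ∀ r ∈ 𝔪 ^ n, ∀ x : A, r • x = 0 := fun r hr x => Subtype.ext (quot_smul_zero _ r hr x.1)
  have inj := ι_inj hlow c n
  let I : Ideal R := A.comap (Submodule.mkQ (𝔪 ^ n))
  let b : A → ((R ⧸ 𝔪 ^ n) →ₗ[R] A) := fun x => cx _ x (fun r hr => hkill r hr x)
  have hb : ∀ x, b x (q1 _) = x := fun x => cx_q1 _ _ _
  let ev : A →ₗ[R] E R (R ⧸ 𝔪 ^ n) M d :=
    { toFun := fun x => pull (b x) ξ
      map_add' := by
        intro x y
        have h : b (x + y) = b x + b y := hom_q1 (by rw [LinearMap.add_apply, hb, hb, hb])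
        change pull (b (x + y)) ξ = pull (b x) ξ + pull (b y) ξ
        rw [h, pull_add]
      map_smul' := by
        intro r x
        have h : b (r • x) = r • b x := hom_q1 (by rw [LinearMap.smul_apply, hb, hb])
        change pull (b (r • x)) ξ = r • pull (b x) ξ
        rw [h, pull_smul] }
  let ρ : I →ₗ[R] A := (Submodule.mkQ (𝔪 ^ n)).restrict (fun x hx => hx)
  obtain ⟨g, hg⟩ := Module.Baer.of_injective hH I (c.ι n ∘ₗ ev ∘ₗ ρ)
  have hg' : ∀ x (hx : x ∈ I), x • g 1 = c.ι n (ev (ρ ⟨x, hx⟩)) := by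
    intro x hx
    rw [← map_smul, smul_eq_mul, mul_one]
    exact hg x hx
  have hle : 𝔪 ^ n ≤ I := by
    intro r hr
    change Submodule.mkQ (𝔪 ^ n) r ∈ A
    rw [← q1_smul, (q1_zero _ r).2 hr]; exact zero_mem _
  obtain ⟨ζ, hζ⟩ := ι_range hlow c n (g 1) (by
    intro r hr
    rw [hg' r (hle hr)]
    have : ρ ⟨r, hle hr⟩ = 0 := Subtype.ext ((q1_smul _ r).symm.trans ((q1_zero _ r).2 hr))
    rw [this, map_zero, map_zero])
  have hζ' : ∀ x (hx : x ∈ I), x • (ζ : E R (R ⧸ 𝔪 ^ n) M d) = ev (ρ ⟨x, hx⟩) := by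
    intro x hx
    apply inj
    rw [← hg' x hx, ← hζ]
    exact map_smul _ _ _
  refine ⟨ζ, ?_⟩
  rw [← sub_eq_zero]
  refine phi_inj hlow n hkill _ fun f => ?_
  rw [map_sub, pull_pull, sub_eq_zero]
  obtain ⟨r, hr⟩ := q1_exists _ (f (q1 _)).1
  have hrI : r ∈ I := by
    change Submodule.mkQ (𝔪 ^ n) r ∈ A
    rw [← q1_smul, hr]; exact (f (q1 _)).2
  have h1 : A.subtype ∘ₗ f = r • LinearMap.id := hom_q1 hr.symm
  rw [h1, pull_smul, pull_id, hζ' r hrI]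
  have h2 : b (ρ ⟨r, hrI⟩) = f := hom_q1 (by
    rw [hb]
    apply Subtype.ext
    rw [← hr, q1_smul]; rfl)
  change pull (b (ρ ⟨r, hrI⟩)) ξ = _
  rw [h2]

lemma kill_k (i : ℕ) (hEff : Eff 𝔪 M i) (ξ : E R (R ⧸ 𝔪) M i) :
    ∃ (n : ℕ) (u : (R ⧸ 𝔪 ^ n) →ₗ[R] (R ⧸ 𝔪)), Function.Surjective u ∧ pull u ξ = 0 := by
  obtain ⟨B, _, _, f, hB, hf, e⟩ := hEff (R ⧸ 𝔪) 
    ⟨inferInstance, 1, fun r hr a => quot_smul_zero _ r (by rwa [pow_one] at hr) a⟩ ξ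
  obtain ⟨_, n, hn⟩ := hB
  obtain ⟨b, hb⟩ := hf (q1 _)
  refine ⟨n, f ∘ₗ cx _ b (fun r hr => hn r hr b), ?_, ?_⟩
  · intro y
    obtain ⟨r, rfl⟩ := q1_exists _ y
    refine ⟨r • q1 _, ?_⟩
    rw [map_smul, LinearMap.comp_apply, cx_q1, hb]
  · rw [← pull_pull, e, map_zero]

lemma vanish_of_inj (hd : ringKrullDim R = d) [Module.Finite R M] (hlow : ∀ i < d, EV R (R ⧸ 𝔪) M i)
    (c : ColimData 𝔪 (ModuleCat.of R M) d H) (hH : Module.Injective R H) (i : ℕ) :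
    EV R (R ⧸ 𝔪) M (d + 1 + i) := by
  induction i with
  | zero =>
    intro ξ
    obtain ⟨n, u, hu, e⟩ := kill_k (d+1) (eff_all d hd M inferInstance _ (by omega)) ξ
    have S := SES.ker u hu
    obtain ⟨η, rfl⟩ := S.ex₃ ξ e
    obtain ⟨ζ, rfl⟩ := ext_of_inj hlow c hH n _ η
    exact S.del_pull ζ
  | succ i ih =>
    intro ξ
    obtain ⟨n, u, hu, e⟩ := kill_k (d+1+i+1) (eff_all d hd M inferInstance _ (by omega)) ξ
    have S := SES.ker u hu
    obtain ⟨η, h⟩ := S.ex₃ (i := d+1+i) ξ e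
    rw [← h, EV_FL ih _ ((FL_pow _ n).sub (LinearMap.ker u).subtype Subtype.val_injective) η, map_zero]
end s7

lemma rgrade_low [IsNoetherianRing R] [IsLocalRing R] (d : ℕ)
    (M : Type u) [AddCommGroup M] [Module R M]
    (h : rgrade R (IsLocalRing.maximalIdeal R) M = d) : 
    ∀ i < d, EV R (R ⧸ IsLocalRing.maximalIdeal R) M i := by
  intro i hi ξ
  have h1 := Nat.notMem_of_lt_sInf (h ▸ hi : i < rgrade R (IsLocalRing.maximalIdeal R) M)
  rw [Set.mem_setOf_eq, not_nontrivial_iff_subsingleton] at h1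
  obtain ⟨x, rfl⟩ := (oldEquiv (ModuleCat.of R (R ⧸ IsLocalRing.maximalIdeal R))
    (ModuleCat.of R M) i).surjective ξ
  have : x = 0 := h1.elim _ _
  rw [this, map_zero]

lemma rid_bound (M : Type u) [AddCommGroup M] [Module R M] (h : rid R M ≠ ⊤) :
    ∃ n : ℕ, ∀ i > n, ∀ (N : Type u) [AddCommGroup N] [Module R N], EV R N M i := by
  obtain ⟨n, hn⟩ := ENat.ne_top_iff_exists.1 h
  refine ⟨n, fun i hi N _ _ ξ => ?_⟩
  by_contra hξ
  have h1 : (i : ℕ∞) ≤ rid R M := by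
    refine le_sSup ⟨i, ⟨ModuleCat.of R N, ?_⟩, rfl⟩
    exact ⟨(oldEquiv (ModuleCat.of R N) (ModuleCat.of R M) i).symm ξ, 0, fun h2 => hξ (by
      rwa [LinearEquiv.map_eq_zero_iff] at h2)⟩
  rw [← hn] at h1
  have h3 : i ≤ n := by exact_mod_cast h1
  omega

lemma rid_ne_top (M : Type u) [AddCommGroup M] [Module R M] (n : ℕ) 
    (h : ∀ i > n, ∀ (N : Type u) [AddCommGroup N] [Module R N], EV R N M i) : rid R M ≠ ⊤ := by
  have : rid R M ≤ (n : ℕ∞) := by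
    refine sSup_le ?_
    rintro _ ⟨i, ⟨N, hN⟩, rfl⟩
    by_contra hi
    have hi' : n < i := by
      by_contra h'
      exact hi (Nat.cast_le (α := ℕ∞).2 (not_lt.1 h'))
    obtain ⟨x, y, hxy⟩ := hN
    apply hxy
    apply (oldEquiv N (ModuleCat.of R M) i).injective
    exact (h i hi' N (oldEquiv N (ModuleCat.of R M) i x)).trans
      (h i hi' N (oldEquiv N (ModuleCat.of R M) i y)).symm
  exact ne_top_of_le_ne_top (ENat.coe_ne_top n) this
end GorAux

/-- over a `d`-dimensional Noetherian local ring, a nonzero finitely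
generated module `M` is Gorenstein (maximal Cohen-Macaulay of finite injective
dimension) iff `M` is maximal Cohen-Macaulay and `H^d_m(M)` is Artinian injective. -/
theorem stmt12 [IsNoetherianRing R] [IsLocalRing R]
    (d : ℕ) (hd : ringKrullDim R = d)
    (M : Type u) [AddCommGroup M] [Module R M] [Module.Finite R M] [Nontrivial M] :
    (rgrade R (IsLocalRing.maximalIdeal R) M = d ∧ rid R M ≠ ⊤) ↔
      (rgrade R (IsLocalRing.maximalIdeal R) M = d ∧
        IsArtinian R (localCoh R (IsLocalRing.maximalIdeal R) d M) ∧
        Module.Injective R (localCoh R (IsLocalRing.maximalIdeal R) d M)) := by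
  constructor
  · rintro ⟨h1, h2⟩
    have hlow := GorAux.rgrade_low R d M h1
    obtain ⟨c⟩ := GorAux.exists_colimData (R := R) (IsLocalRing.maximalIdeal R) M d
    obtain ⟨n, hn⟩ := GorAux.rid_bound R M h2
    have h3 := GorAux.descend d hd M n (fun i hi => hn i hi _)
    exact ⟨h1, GorAux.artinian_H hlow c, GorAux.injective_H hlow c (h3 (d+1) (by omega))⟩
  · rintro ⟨h1, _, h2⟩
    have hlow := GorAux.rgrade_low R d M h1
    obtain ⟨c⟩ := GorAux.exists_colimData (R := R) (IsLocalRing.maximalIdeal R) M d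
    refine ⟨h1, GorAux.rid_ne_top R M d (fun i hi N _ _ => GorAux.all_of_k d ?_ N i hi)⟩
    intro j hj
    obtain ⟨e, rfl⟩ := Nat.exists_eq_add_of_le (show d + 1 ≤ j from hj)
    exact GorAux.vanish_of_inj hd hlow c h2 e
end

section
/- Let (R,𝔪) be a Noetherian local ring, 𝔞 a proper ideal with pd_R(R/𝔞) < ∞. Then for every nonzero finitely generated R-module M, the 𝔞-relative injective dimension of M equals pd_R(R/𝔞), i.e., sup{i : Ext^i_R(R/𝔞,M) ≠ 0} = pd_R(R/𝔞). -/
open CategoryTheory Opposite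
open scoped TensorProduct

universe u

variable (R : Type u) [CommRing R]

section Aux

variable {R}

lemma aux_exact_iff {X : ModuleCat.{u} R} (P : ProjectiveResolution X) (Y : ModuleCat.{u} R)
    (n : ℕ) :
    Subsingleton (((Ext R (ModuleCat.{u} R) n).obj (op X)).obj Y) ↔
      ∀ f : P.complex.X n ⟶ Y, P.complex.d (n + 1) n ≫ f = 0 →
        ∃ g : P.complex.X ((ComplexShape.up ℕ).prev n) ⟶ Y, P.complex.d n _ ≫ g = f := by
  rw [← ModuleCat.isZero_iff_subsingleton, (P.isoExt (R := R) n Y).isZero_iff,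
    ← HomologicalComplex.exactAt_iff_isZero_homology,
    HomologicalComplex.exactAt_iff' _ ((ComplexShape.up ℕ).prev n) n (n + 1) rfl (by simp),
    ShortComplex.moduleCat_exact_iff]
  rfl

lemma aux_bridge (X Y : ModuleCat.{u} R) (n : ℕ) :
    Subsingleton (((Ext R (ModuleCat.{u} R) n).obj (op X)).obj Y) ↔
      Subsingleton (Abelian.Ext.{u} X Y n) := by
  have P : ProjectiveResolution X := projectiveResolution X
  rw [aux_exact_iff P]
  cases n with
  | zero =>
    rw [Abelian.Ext.homEquiv₀.subsingleton_congr]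
    have hz : P.complex.d 0 ((ComplexShape.up ℕ).prev 0) = 0 :=
      P.complex.shape _ _ (by simp)
    simp only [hz, Limits.zero_comp]
    constructor
    · intro h
      refine ⟨fun a b => ?_⟩
      rw [← sub_eq_zero]
      let p : P.complex.X 0 ⟶ X := P.π.f 0
      have hp : Epi p := inferInstanceAs (Epi (P.π.f 0))
      have hd : P.complex.d 1 0 ≫ p = 0 := P.complex_d_comp_π_f_zero
      obtain ⟨_, hg⟩ := h (p ≫ (a - b)) (by rw [← Category.assoc, hd, Limits.zero_comp])
      exact (cancel_epi p).1 (hg.symm.trans Limits.comp_zero.symm)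
    · intro h f hf
      refine ⟨0, ?_⟩
      obtain ⟨g, hg⟩ := Limits.CokernelCofork.IsColimit.desc' P.exact₀.gIsCokernel f hf
      rw [← hg, h.elim g 0]
      exact (Limits.comp_zero).symm
  | succ n =>
    have hp : (ComplexShape.up ℕ).prev (n + 1) = n := by simp
    rw [hp]
    constructor
    · intro h
      refine subsingleton_of_forall_eq 0 fun α => ?_
      obtain ⟨f, hf, rfl⟩ := P.extMk_surjective α _ rfl
      rw [P.extMk_eq_zero_iff _ _ _ _ n rfl]
      exact h f hf
    · intro h f hf
      rw [← P.extMk_eq_zero_iff f _ rfl hf n rfl]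
      exact h.elim _ _

variable [IsLocalRing R]

lemma aux_free {K F X : Type u} [AddCommGroup K] [Module R K] [AddCommGroup F] [Module R F]
    [AddCommGroup X] [Module R X] [Module.Finite R K] [Module.Finite R F] [Module.Free R F]
    (f : K →ₗ[R] F) (g : F →ₗ[R] X) (hg : Function.Surjective g) (h : Function.Exact f g)
    (hext : ∀ φ : K →ₗ[R] IsLocalRing.ResidueField R,
      ∃ ψ : F →ₗ[R] IsLocalRing.ResidueField R, ψ ∘ₗ f = φ) : Module.Free R X := by
  refine Module.free_of_lTensor_residueField_injective f g hg h ?_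
  rw [injective_iff_map_eq_zero]
  intro v hv
  refine ((Module.forall_dual_apply_eq_zero_iff (IsLocalRing.ResidueField R) v).1 fun φ => ?_)
  obtain ⟨ψ, hψ⟩ := hext (φ.restrictScalars R ∘ₗ TensorProduct.mk R _ K 1)
  have : φ.restrictScalars R = (LinearMap.mul' R _ ∘ₗ ψ.lTensor _) ∘ₗ f.lTensor _ := by
    refine TensorProduct.ext' fun c x => ?_
    have h1 := LinearMap.congr_fun hψ x
    simp only [LinearMap.comp_apply, TensorProduct.mk_apply, LinearMap.restrictScalars_apply] at h1
    have h2 : c ⊗ₜ[R] x = c • ((1 : IsLocalRing.ResidueField R) ⊗ₜ[R] x) := by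
      simp [TensorProduct.smul_tmul']
    have h3 : φ (c ⊗ₜ[R] x) = c * φ (1 ⊗ₜ[R] x) := by rw [h2, map_smul, smul_eq_mul]
    simp [h1, h3]
  have h5 := LinearMap.congr_fun this v
  simpa [hv] using h5

open Abelian in
lemma aux_pd [IsNoetherianRing R] (n : ℕ) (X : ModuleCat.{u} R) [Module.Finite R X]
    (h : Subsingleton (Abelian.Ext.{u} X (ModuleCat.of R (IsLocalRing.ResidueField R)) (n + 1))) :
    HasProjectiveDimensionLT X (n + 1) := by
  induction n generalizing X with
  | zero =>
    obtain ⟨F, _, _, _, _, f, hf⟩ := Module.exists_finite_presentation R X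
    have hS := LinearMap.shortExact_shortComplexKer hf
    have : Module.Free R X := by
      refine aux_free (LinearMap.ker f).subtype f hf (LinearMap.exact_subtype_ker_map f) ?_
      intro φ
      obtain ⟨y, hy⟩ := Ext.contravariant_sequence_exact₁ hS _
        (Ext.mk₀ (ModuleCat.ofHom φ)) (n₁ := 1) rfl (h.elim _ _)
      obtain ⟨y, rfl⟩ := Ext.homEquiv₀.symm.surjective y
      refine ⟨y.hom, ?_⟩
      have := Ext.homEquiv₀.symm.injective
        (a₁ := ModuleCat.ofHom (LinearMap.ker f).subtype ≫ y) (a₂ := ModuleCat.ofHom φ)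
        (by simpa using hy)
      exact congrArg ModuleCat.Hom.hom this
    have : Module.Projective R X := Module.Projective.of_free
    have : Projective X := ModuleCat.projective_of_categoryTheory_projective X
    infer_instance
  | succ n ih =>
    obtain ⟨F, _, _, _, _, f, hf⟩ := Module.exists_finite_presentation R X
    have hS := LinearMap.shortExact_shortComplexKer hf
    have hP : Projective f.shortComplexKer.X₂ :=
      ModuleCat.projective_of_categoryTheory_projective f.shortComplexKer.X₂
    rw [show n + 1 + 1 = n + 2 from rfl]
    refine (hS.hasProjectiveDimensionLT_X₃_iff n hP).2 ?_
    have : Module.Finite R f.shortComplexKer.X₁ :=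
      inferInstanceAs (Module.Finite R (LinearMap.ker f))
    refine ih _ (subsingleton_of_forall_eq 0 fun x => ?_)
    obtain ⟨y, rfl⟩ := Ext.contravariant_sequence_exact₁ hS _ x (add_comm _ _) (h.elim _ _)
    rw [y.eq_zero_of_projective, Ext.comp_zero]

lemma aux_surj (M : ModuleCat.{u} R) [Module.Finite R M] [Nontrivial M] :
    ∃ f : M →ₗ[R] IsLocalRing.ResidueField R, Function.Surjective f := by
  obtain ⟨N, hN, -⟩ := (eq_top_or_exists_le_coatom (⊥ : Submodule R M)).resolve_left bot_ne_top
  have : IsSimpleModule R (M ⧸ N) := isSimpleModule_iff_isCoatom.2 hN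
  obtain ⟨I, hI, ⟨e⟩⟩ := isSimpleModule_iff_quot_maximal.1 this
  obtain rfl := IsLocalRing.eq_maximalIdeal hI
  exact ⟨e.toLinearMap ∘ₗ N.mkQ, e.surjective.comp N.mkQ_surjective⟩

open Abelian in
lemma aux_residue (X M : ModuleCat.{u} R) [Module.Finite R M] [Nontrivial M] (n : ℕ)
    [HasProjectiveDimensionLT X (n + 1)] (h : Subsingleton (Abelian.Ext.{u} X M n)) :
    Subsingleton (Abelian.Ext.{u} X (ModuleCat.of R (IsLocalRing.ResidueField R)) n) := by
  obtain ⟨f, hf⟩ := aux_surj M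
  have hS := LinearMap.shortExact_shortComplexKer hf
  refine subsingleton_of_forall_eq 0 fun x => ?_
  obtain ⟨y, rfl⟩ := Ext.covariant_sequence_exact₃ X hS x rfl
    (Ext.eq_zero_of_hasProjectiveDimensionLT _ (n + 1) le_rfl)
  rw [h.elim y 0, Ext.zero_comp]

lemma aux_main [IsNoetherianRing R] (X M : ModuleCat.{u} R) [Module.Finite R X] [Nontrivial X]
    [Module.Finite R M] [Nontrivial M] (n : ℕ)
    [HasProjectiveDimensionLT X (n + 1)] (h : Subsingleton (Abelian.Ext.{u} X M n)) :
    HasProjectiveDimensionLT X n := by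
  cases n with
  | succ n => exact aux_pd n X (aux_residue X M (n + 1) h)
  | zero =>
    exfalso
    have h2 := aux_residue X M 0 h
    rw [Abelian.Ext.homEquiv₀.subsingleton_congr] at h2
    obtain ⟨f, hf⟩ := aux_surj X
    obtain ⟨x, hx⟩ := hf 1
    have h3 := congrArg ModuleCat.Hom.hom (h2.elim (ModuleCat.ofHom f) 0)
    have h4 : f = 0 := h3
    rw [h4] at hx
    exact zero_ne_one hx

end Aux

/-- over a Noetherian local ring, if `pd_R(R/a) < ∞` then the
`a`-relative injective dimension of any nonzero finitely generated module equals
`pd_R(R/a)`. -/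
theorem stmt13 [IsNoetherianRing R] [IsLocalRing R] (a : Ideal R) (ha : a ≠ ⊤)
    (hpd : rpd R (R ⧸ a) ≠ ⊤)
    (M : Type u) [AddCommGroup M] [Module R M] [Module.Finite R M] [Nontrivial M] :
    raid R a M = rpd R (R ⧸ a) := by
  have : Nontrivial (R ⧸ a) := Ideal.Quotient.nontrivial_iff.2 ha
  unfold raid rpd relExt at *
  have key : ∀ n : ℕ, HasProjectiveDimensionLT (ModuleCat.of R (R ⧸ a)) n ↔
    ∀ i, n ≤ i → ∀ Y, ¬ Nontrivial (((Ext R (ModuleCat R) i).obj (op (ModuleCat.of R (R ⧸ a)))).obj Y) := by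
    intro n
    simp only [not_nontrivial_iff_subsingleton, aux_bridge]
    rw [hasProjectiveDimensionLT_iff.{u}]
    exact forall_congr' fun i => forall_congr' fun hi => forall_congr' fun Y =>
      ⟨fun h => subsingleton_of_forall_eq 0 h, fun h e => h.elim _ _⟩
  apply le_antisymm
  · exact sSup_le_sSup (Set.image_mono fun i hi => ⟨_, hi⟩)
  · have hex : ∃ n, HasProjectiveDimensionLT (ModuleCat.of R (R ⧸ a)) n := by
      obtain ⟨m, hm⟩ := ENat.ne_top_iff_exists.1 hpd
      refine ⟨m + 1, (key _).2 fun i hi Y hY => ?_⟩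
      have := le_sSup (Set.mem_image_of_mem (fun i : ℕ => (i : ℕ∞)) (show i ∈ {i : ℕ | ∃ N : ModuleCat R,
        Nontrivial (((Ext R (ModuleCat R) i).obj (op (ModuleCat.of R (R ⧸ a)))).obj N)} from ⟨Y, hY⟩))
      rw [← hm] at this
      have := ENat.natCast_le_natCast.1 this
      lia
    classical
    obtain ⟨n, hn, hmin⟩ : ∃ n, HasProjectiveDimensionLT (ModuleCat.of R (R ⧸ a)) n ∧
        ∀ m < n, ¬ HasProjectiveDimensionLT (ModuleCat.of R (R ⧸ a)) m :=
      ⟨_, Nat.find_spec hex, fun m hm => Nat.find_min hex hm⟩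
    cases n with
    | zero =>
      have := isZero_of_hasProjectiveDimensionLT_zero (ModuleCat.of R (R ⧸ a))
      rw [ModuleCat.isZero_iff_subsingleton] at this
      exact (not_subsingleton (R ⧸ a) this).elim
    | succ n =>
      apply sSup_le
      rintro _ ⟨i, ⟨Y, hY⟩, rfl⟩
      have hi : i ≤ n := by
        by_contra hlt
        exact (key _).1 hn i (by lia) Y hY
      refine le_trans (b := (n : ℕ∞)) (Nat.cast_le.2 hi) (le_sSup ⟨n, ?_, rfl⟩)
      by_contra hnt
      have hnt := (aux_bridge _ _ _).1 (not_nontrivial_iff_subsingleton.1 hnt)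
      exact hmin n (by lia) (aux_main _ _ n hnt)
end

section
/- Let 𝔞 be an ideal of R, M a finitely generated R-module with M ≠ 𝔞M, and x ∈ 𝔞 a nonzero-divisor on M. Then sup{i : Ext^i_R(R/𝔞, M) ≠ 0} = sup{i : Ext^i_R(R/𝔞, M/xM) ≠ 0}. -/
open CategoryTheory Opposite
open scoped TensorProduct

universe u

variable (R : Type u) [CommRing R]

section helpers

open CategoryTheory.Limits

variable {R}

lemma aux_ext_trivial_iff (X Y : ModuleCat.{u} R) (n : ℕ) :
    IsZero (((Ext R (ModuleCat R) n).obj (op X)).obj Y) ↔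
      Subsingleton (Abelian.Ext X Y n) := by
  let P : ProjectiveResolution X := projectiveResolution X
  rw [(P.isoExt (R := R) n Y).isZero_iff, ← HomologicalComplex.exactAt_iff_isZero_homology]
  cases n with
  | zero =>
    rw [HomologicalComplex.exactAt_iff' _ 0 0 1 (by simp) (by simp),
      ShortComplex.moduleCat_exact_iff, Abelian.Ext.homEquiv₀.subsingleton_congr]
    have hd0 : P.complex.d 0 0 = 0 := P.complex.shape _ _ (by simp)
    change _ ↔ Subsingleton (((ChainComplex.single₀ (ModuleCat R)).obj X).X 0 ⟶ Y)
    constructor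
    · intro h
      refine subsingleton_of_forall_eq 0 fun e => ?_
      obtain ⟨g, hg⟩ := h (P.π.f 0 ≫ e) (show P.complex.d 1 0 ≫ P.π.f 0 ≫ e = 0 by
        rw [← Category.assoc, P.complex_d_comp_π_f_zero, zero_comp])
      have hg' : P.complex.d 0 0 ≫ (show P.complex.X 0 ⟶ Y from g) = P.π.f 0 ≫ e := hg
      rw [hd0, zero_comp] at hg'
      rw [← cancel_epi (P.π.f 0), ← hg', comp_zero]
    · intro h f hf
      have hf' : P.complex.d 1 0 ≫ (show P.complex.X 0 ⟶ Y from f) = 0 := hf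
      refine ⟨0, ?_⟩
      rw [map_zero]
      have h1 := P.exact₀.g_desc (k := (show P.complex.X 0 ⟶ Y from f)) hf'
      rw [h.elim (P.exact₀.desc _ hf') 0, comp_zero] at h1
      exact h1
  | succ n =>
    rw [HomologicalComplex.exactAt_iff' _ n (n+1) (n+2) (by simp) (by simp),
      ShortComplex.moduleCat_exact_iff]
    constructor
    · intro h
      refine subsingleton_of_forall_eq 0 fun e => ?_
      obtain ⟨f, hf, rfl⟩ := P.extMk_surjective e (n+2) rfl
      rw [P.extMk_eq_zero_iff _ _ _ _ n rfl]
      exact h f hf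
    · intro h f hf
      exact (P.extMk_eq_zero_iff f (n+2) rfl hf n rfl).1 (Subsingleton.elim _ _)

lemma aux_relExt_iff (a : Ideal R) (i : ℕ) (M : Type u) [AddCommGroup M] [Module R M] :
    Nontrivial (relExt R a i M) ↔
      Nontrivial (Abelian.Ext (ModuleCat.of R (R ⧸ a)) (ModuleCat.of R M) i) := by
  rw [← not_subsingleton_iff_nontrivial, ← not_subsingleton_iff_nontrivial,
    ← aux_ext_trivial_iff, ModuleCat.isZero_iff_subsingleton]
  rfl

lemma aux_smul_zero (a : Ideal R) (x : R) (hx : x ∈ a) (Y : ModuleCat.{u} R) (n : ℕ)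
    (e : Abelian.Ext (ModuleCat.of R (R ⧸ a)) Y n) :
    e.comp (Abelian.Ext.mk₀ (x • 𝟙 Y)) (add_zero n) = 0 := by
  have hm : x ∈ Module.annihilator R (ModuleCat.of R (R ⧸ a)) := by
    change x ∈ Module.annihilator R (R ⧸ a)
    rwa [Ideal.annihilator_quotient]
  have := Abelian.Ext.postcomp_smul_id_eq_zero_of_mem_annihilator (M := Y) hm n
  exact congrArg (fun f => f.hom e) this

lemma aux_ext_nontriv (a : Ideal R) (S : ShortComplex (ModuleCat.{u} R))
    (hS : S.ShortExact)
    (h0 : ∀ (n : ℕ) (e : Abelian.Ext (ModuleCat.of R (R ⧸ a)) S.X₁ n),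
      e.comp (Abelian.Ext.mk₀ S.f) (add_zero n) = 0) (n : ℕ) :
    (Nontrivial (Abelian.Ext (ModuleCat.of R (R ⧸ a)) S.X₂ n) →
      Nontrivial (Abelian.Ext (ModuleCat.of R (R ⧸ a)) S.X₃ n)) ∧
    (Nontrivial (Abelian.Ext (ModuleCat.of R (R ⧸ a)) S.X₃ n) →
      Nontrivial (Abelian.Ext (ModuleCat.of R (R ⧸ a)) S.X₂ n) ∨
      Nontrivial (Abelian.Ext (ModuleCat.of R (R ⧸ a)) S.X₁ (n + 1))) := by
  constructor
  · contrapose!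
    intro h
    refine subsingleton_of_forall_eq 0 fun e => ?_
    obtain ⟨e', rfl⟩ := Abelian.Ext.covariant_sequence_exact₂ _ hS e (Subsingleton.elim _ _)
    exact h0 n e'
  · contrapose!
    rintro ⟨h, h'⟩
    refine subsingleton_of_forall_eq 0 fun e => ?_
    obtain ⟨e', rfl⟩ := Abelian.Ext.covariant_sequence_exact₃ _ hS e rfl (Subsingleton.elim _ _)
    rw [Subsingleton.elim e' 0, Abelian.Ext.zero_comp]

end helpers

/-- `a`-relative injective dimension is unchanged by factoring out a
nonzerodivisor `x ∈ a` on `M`. -/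
theorem stmt14 [IsNoetherianRing R] (a : Ideal R) (ha : a ≠ ⊤)
    (M : Type u) [AddCommGroup M] [Module R M] [Module.Finite R M]
    (hne : a • (⊤ : Submodule R M) ≠ ⊤)
    (x : R) (hx : x ∈ a) (hreg : IsSMulRegular M x) :
    raid R a M = raid R a (M ⧸ (Ideal.span {x} • ⊤ : Submodule R M)) := by
  rw [Submodule.ideal_span_singleton_smul]
  have key := aux_ext_nontriv a (ModuleCat.smulShortComplex (ModuleCat.of R M) x)
    (IsSMulRegular.smulShortComplex_shortExact (M := ModuleCat.of R M) hreg)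
    (fun n e => aux_smul_zero a x hx (ModuleCat.of R M) n e)
  unfold raid
  simp only [aux_relExt_iff]
  apply le_antisymm
  · refine sSup_le_sSup (Set.image_mono fun i hi => ?_)
    exact (key i).1 hi
  · refine sSup_le ?_
    rintro _ ⟨i, hi, rfl⟩
    rcases (key i).2 hi with h | h
    · exact le_sSup ⟨i, h, rfl⟩
    · exact le_trans (Nat.cast_le.2 (Nat.le_succ i)) (le_sSup ⟨i + 1, h, rfl⟩)
end

section
/- Let 𝔞 be an ideal of R contained in its Jacobson radical and M a nonzero 𝔞-relative regular R-module. Then pd_R(M/𝔞M) = pd_R M + cd(𝔞,R). -/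
open CategoryTheory Opposite
open scoped TensorProduct

universe u

variable (R : Type u) [CommRing R]

section Helpers

open CategoryTheory.Abelian RingTheory.Sequence

variable {R}

lemma aux_quot [IsNoetherianRing R] (M : ModuleCat.{u} R)
    [Module.Finite R M] (x : R) (reg : IsSMulRegular M x) (mem : x ∈ (⊥ : Ideal R).jacobson)
    (n : ℕ) :
    HasProjectiveDimensionLT (ModuleCat.of R (QuotSMulTop x M)) (n + 1) ↔
      HasProjectiveDimensionLT M n := by
  let S := M.smulShortComplex x
  have hS : S.ShortExact := reg.smulShortComplex_shortExact
  refine ⟨fun h ↦ ?_, fun h ↦ hS.hasProjectiveDimensionLT_X₃ n h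
    (hasProjectiveDimensionLT_of_ge M n (n + 1) (Nat.le_add_right _ 1))⟩
  apply ModuleCat.hasProjectiveDimensionLT_of_forall_finite
  intro L _
  have zero := HasProjectiveDimensionLT.subsingleton (ModuleCat.of R (QuotSMulTop x M))
    (n + 1) _ (le_refl _) L
  have surj : ∀ y : CategoryTheory.Abelian.Ext M L n,
      ∃ z : CategoryTheory.Abelian.Ext M L n, x • z = y := by
    intro y
    obtain ⟨z, hz⟩ := Ext.contravariant_sequence_exact₁ hS L y (add_comm 1 n) (zero.elim _ _)
    have hf : Ext.mk₀ S.f = x • Ext.mk₀ (𝟙 M) := Ext.mk₀_smul x (𝟙 M)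
    refine ⟨z, Eq.trans ?_ hz⟩
    have e : ∀ z : CategoryTheory.Abelian.Ext M L n,
        (x • Ext.mk₀ (𝟙 M)).comp z (zero_add n) = x • z := fun z ↦ by
      rw [Ext.smul_comp, Ext.mk₀_id_comp]
    exact (e z).symm.trans (congrArg (fun w => Ext.comp w z (zero_add n)) hf).symm
  by_contra! ntr
  have : x ∈ (Module.annihilator R (CategoryTheory.Abelian.Ext M L n)).jacobson :=
    Ideal.jacobson_mono bot_le mem
  refine Submodule.top_ne_pointwise_smul_of_mem_jacobson_annihilator this ?_
  rw [eq_comm, eq_top_iff]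
  intro y _
  obtain ⟨z, rfl⟩ := surj y
  exact Submodule.smul_mem_pointwise_smul _ _ ⊤ trivial

lemma aux_iso {X Y : ModuleCat.{u} R} (e : X ≅ Y) (n : ℕ) :
    HasProjectiveDimensionLT X n ↔ HasProjectiveDimensionLT Y n :=
  ⟨fun _ ↦ hasProjectiveDimensionLT_of_iso e n, fun _ ↦ hasProjectiveDimensionLT_of_iso e.symm n⟩

lemma aux_list [IsNoetherianRing R] (rs : List R) (M : ModuleCat.{u} R)
    [Module.Finite R M] (reg : IsWeaklyRegular M rs)
    (mem : ∀ r ∈ rs, r ∈ (⊥ : Ideal R).jacobson) (n : ℕ) :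
    HasProjectiveDimensionLT (ModuleCat.of R (M ⧸ Ideal.ofList rs • (⊤ : Submodule R M)))
      (n + rs.length) ↔ HasProjectiveDimensionLT M n := by
  induction rs generalizing M n with
  | nil =>
    rw [Ideal.ofList_nil, Submodule.bot_smul]
    exact aux_iso (Submodule.quotEquivOfEqBot ⊥ rfl).toModuleIso _
  | cons x rs' ih =>
    simp only [List.mem_cons, forall_eq_or_imp] at mem
    simp only [isWeaklyRegular_cons_iff] at reg
    rw [aux_iso (Submodule.quotOfListConsSMulTopEquivQuotSMulTopInner M x rs').toModuleIso,
      List.length_cons, show n + (rs'.length + 1) = (n + 1) + rs'.length by omega,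
      ← aux_quot M x reg.1 mem.1 n]
    exact ih (ModuleCat.of R (QuotSMulTop x M)) reg.2 mem.2 (n + 1)

lemma aux_ext (X Y : ModuleCat.{u} R) (k : ℕ) :
    Subsingleton (((_root_.Ext R (ModuleCat R) (k + 1)).obj (op X)).obj Y) ↔
      Subsingleton (CategoryTheory.Abelian.Ext X Y (k + 1)) := by
  let P := projectiveResolution X
  have h1 : Subsingleton (((_root_.Ext R (ModuleCat R) (k + 1)).obj (op X)).obj Y) ↔
      ∀ f : P.complex.X (k + 1) ⟶ Y, P.complex.d (k + 2) (k + 1) ≫ f = 0 →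
        ∃ g : P.complex.X k ⟶ Y, P.complex.d (k + 1) k ≫ g = f := by
    rw [← ModuleCat.isZero_iff_subsingleton, (P.isoExt (R := R) (k + 1) Y).isZero_iff,
      ← HomologicalComplex.exactAt_iff_isZero_homology,
      HomologicalComplex.exactAt_iff' _ k (k + 1) (k + 2) (by simp) (by simp),
      ShortComplex.moduleCat_exact_iff]
    rfl
  rw [h1]
  constructor
  · intro h
    refine subsingleton_of_forall_eq 0 fun α ↦ ?_
    obtain ⟨f, hf, rfl⟩ := P.extMk_surjective α (k + 2) rfl
    exact (P.extMk_eq_zero_iff f (k + 2) rfl hf k rfl).2 (h f hf)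
  · intro h f hf
    exact (P.extMk_eq_zero_iff f (k + 2) rfl hf k rfl).1 (Subsingleton.elim _ _)

lemma aux_rpd (M : Type u) [AddCommGroup M] [Module R M] (n : ℕ) :
    rpd R M ≤ n ↔ HasProjectiveDimensionLT (ModuleCat.of R M) (n + 1) := by
  rw [hasProjectiveDimensionLT_iff]
  simp only [rpd, sSup_le_iff, Set.mem_image, Set.mem_ofPred_eq]
  constructor
  · intro h i hi Y e
    obtain ⟨k, rfl⟩ : ∃ k, i = k + 1 := ⟨i - 1, by omega⟩
    have : Subsingleton (CategoryTheory.Abelian.Ext (ModuleCat.of R M) Y (k + 1)) := by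
      rw [← aux_ext]
      by_contra hc
      have := h _ ⟨k + 1, ⟨Y, not_subsingleton_iff_nontrivial.1 hc⟩, rfl⟩
      have := ENat.natCast_le_natCast.1 this
      omega
    exact Subsingleton.elim _ _
  · rintro h _ ⟨i, ⟨Y, hY⟩, rfl⟩
    by_contra hc
    have hc : n < i := by
      by_contra h'
      exact hc (ENat.natCast_le_natCast.2 (by omega))
    obtain ⟨k, rfl⟩ : ∃ k, i = k + 1 := ⟨i - 1, by omega⟩
    refine not_subsingleton_iff_nontrivial.2 hY ((aux_ext _ _ _).2 ?_)
    exact subsingleton_of_forall_eq 0 fun e ↦ h _ hc e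

end Helpers

/-- if `a` is contained in the Jacobson radical and `M` is a nonzero
`a`-relative regular module, then `pd_R(M/aM) = pd_R M + cd(a,R)`. -/
theorem stmt15 [IsNoetherianRing R] (a : Ideal R)
    (hJac : a ≤ (⊥ : Ideal R).jacobson)
    (M : Type u) [AddCommGroup M] [Module R M] [Module.Finite R M] [Nontrivial M]
    (hreg : IsRelRegularMod R a M) :
    rpd R (M ⧸ (a • ⊤ : Submodule R M)) = rpd R M + ((rcd R a R : ℕ) : ℕ∞) := by
  have key : ∃ rs : List R, rs.length = rcd R a R ∧
      Ideal.ofList rs = a ∧ RingTheory.Sequence.IsRegular M rs := by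
    rcases hreg with h | ⟨-, rs, h1, h2, h3, -⟩
    · exact absurd h.symm (Submodule.top_ne_ideal_smul_of_le_jacobson_annihilator
        (hJac.trans (Ideal.jacobson_mono bot_le)))
    · exact ⟨rs, h1, h2, h3⟩
  obtain ⟨rs, h1, rfl, h3⟩ := key
  rw [← h1]
  have hl := aux_list rs (ModuleCat.of R M) h3.toIsWeaklyRegular
    (fun r hr ↦ hJac (Ideal.subset_span hr))
  refine eq_of_forall_ge_iff fun N ↦ ?_
  induction N with
  | top => simp
  | coe n =>
    rw [aux_rpd]
    rcases le_or_gt rs.length n with h | h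
    · obtain ⟨m, rfl⟩ := Nat.exists_eq_add_of_le' h
      rw [Nat.cast_add, ENat.add_le_add_iff_right (ENat.natCast_ne_top _), aux_rpd, ← hl,
        show m + rs.length + 1 = m + 1 + rs.length by omega]
    · constructor
      · intro h'
        have h0 := (hl 0).1 (hasProjectiveDimensionLT_of_ge _ (n + 1) _ (by omega))
        rw [hasProjectiveDimensionLT_zero_iff_isZero, ModuleCat.isZero_iff_subsingleton] at h0
        exact absurd h0 (not_subsingleton_iff_nontrivial.2 ‹Nontrivial M›)
      · intro h'
        have := ENat.natCast_le_natCast.1 (le_add_self.trans h')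
        omega
end
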